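/- Let p, q be positive integers. The Möbius function of the poset NC^B(p,q) satisfies μ(0̂, 1̂) = (-1)^{p+q} · ( C(2p-1, p) · C(2q-1, q) + Σ_{c=1}^{p} 2c · C(2p-c-1, p-1) · C(2q+c-1, q-1) ). -/

import Mathlib

/-!  Common setup: annular non-crossing partitions of type B, following
Goulden–Nica–Oancea, "Enumerative properties of NC^(B)(p,q)". -/

/-- The underlying set `{±1, …, ±n}`, realized inside `ℤ`. -/
def signedSet (n : ℕ) : Set ℤ := {x : ℤ | x ≠ 0 ∧ |x| ≤ (n : ℤ)}

/-- Membership in the hyperoctahedral group `B_n`, realized as the permutations of `ℤ`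
that commute with negation and fix every point outside `{±1, …, ±n}`. -/
def inB (n : ℕ) (π : Equiv.Perm ℤ) : Prop :=
  (∀ x : ℤ, π (-x) = -(π x)) ∧ ∀ x : ℤ, x ∉ signedSet n → π x = x

/-- The set of generators of `B_n`:
`(i,j)(-i,-j)`, `(i,-j)(-i,j)` for `1 ≤ i ≠ j ≤ n`, and `(i,-i)` for `1 ≤ i ≤ n`. -/
def genB (n : ℕ) : Set (Equiv.Perm ℤ) :=
  {π | (∃ i j : ℤ, 1 ≤ i ∧ i ≤ (n : ℤ) ∧ 1 ≤ j ∧ j ≤ (n : ℤ) ∧ i ≠ j ∧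
          π = Equiv.swap i j * Equiv.swap (-i) (-j)) ∨
       (∃ i j : ℤ, 1 ≤ i ∧ i ≤ (n : ℤ) ∧ 1 ≤ j ∧ j ≤ (n : ℤ) ∧ i ≠ j ∧
          π = Equiv.swap i (-j) * Equiv.swap (-i) j) ∨
       (∃ i : ℤ, 1 ≤ i ∧ i ≤ (n : ℤ) ∧ π = Equiv.swap i (-i))}

/-- The length function `ℓ_B` on `B_n`: the least `k` such that `τ` is a product of `k`
generators from `genB n` (the empty product being the identity). -/
noncomputable def lenB (n : ℕ) (τ : Equiv.Perm ℤ) : ℕ :=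
  sInf {k : ℕ | ∃ l : List (Equiv.Perm ℤ),
    l.length = k ∧ (∀ g ∈ l, g ∈ genB n) ∧ l.prod = τ}

/-- The partial order on `B_n`:  `τ ≤ σ` iff `ℓ_B(σ) = ℓ_B(τ) + ℓ_B(τ⁻¹σ)`. -/
def leB (n : ℕ) (τ σ : Equiv.Perm ℤ) : Prop :=
  lenB n σ = lenB n τ + lenB n (τ⁻¹ * σ)

/-- The permutation `γ_{p,q} = (1,…,p,-1,…,-p)(p+1,…,p+q,-(p+1),…,-(p+q))`. -/
def gammaPQ (p q : ℕ) : Equiv.Perm ℤ :=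
  (((List.range p).map fun i => ((i : ℤ) + 1)) ++
      ((List.range p).map fun i => -((i : ℤ) + 1))).formPerm *
    (((List.range q).map fun i => ((p : ℤ) + (i : ℤ) + 1)) ++
      ((List.range q).map fun i => -((p : ℤ) + (i : ℤ) + 1))).formPerm

/-- The long cycle `γ_n = (1,…,n,-1,…,-n)` of `B_n` (disc case). -/
def gammaDisc (n : ℕ) : Equiv.Perm ℤ :=
  (((List.range n).map fun i => ((i : ℤ) + 1)) ++
    ((List.range n).map fun i => -((i : ℤ) + 1))).formPerm

/-- The annular non-crossing permutations of type B: `S^B_nc(p,q) = [ε, γ_{p,q}] ⊆ B_{p+q}`. -/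
def SncB (p q : ℕ) : Set (Equiv.Perm ℤ) :=
  {τ | inB (p + q) τ ∧ leB (p + q) τ (gammaPQ p q)}

/-- The orbit of `x` under the permutation `τ`. -/
def permOrbit (τ : Equiv.Perm ℤ) (x : ℤ) : Set ℤ := {y | ∃ m : ℤ, (τ ^ m) x = y}

/-- The partition `Ω(τ)` of `{±1,…,±n}` into orbits of `τ`. -/
def orbitsOn (n : ℕ) (τ : Equiv.Perm ℤ) : Set (Set ℤ) :=
  {A | ∃ x ∈ signedSet n, A = permOrbit τ x}

/-- The negation `-A` of a set `A ⊆ ℤ`. -/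
def negSet (A : Set ℤ) : Set ℤ := {x | -x ∈ A}

/-- The partition `Ω̃(τ)`, obtained from `Ω(τ)` by merging all inversion-invariant orbits
(orbits `A` with `A = -A`) into a single block. -/
def omegaTilde (n : ℕ) (τ : Equiv.Perm ℤ) : Set (Set ℤ) :=
  {A | A ∈ orbitsOn n τ ∧ negSet A ≠ A} ∪
    {B | B = ⋃₀ {A | A ∈ orbitsOn n τ ∧ negSet A = A} ∧ B.Nonempty}

/-- The annular non-crossing partitions of type B: `NC^B(p,q) = {Ω̃(τ) : τ ∈ S^B_nc(p,q)}`. -/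
def NCB (p q : ℕ) : Set (Set (Set ℤ)) :=
  {π | ∃ τ ∈ SncB p q, π = omegaTilde (p + q) τ}

/-- The type B non-crossing partitions of the disc: `NC^B(n) = {Ω̃(τ) : τ ∈ B_n, τ ≤ γ_n}`. -/
def NCBdisc (n : ℕ) : Set (Set (Set ℤ)) :=
  {π | ∃ τ, inB n τ ∧ leB n τ (gammaDisc n) ∧ π = omegaTilde n τ}

/-- Reverse refinement order on partitions: every block of `π` is contained in a block of `ρ`. -/
def refines (π ρ : Set (Set ℤ)) : Prop := ∀ A ∈ π, ∃ B ∈ ρ, A ⊆ B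

/-- The rank of a partition of `{±1,…,±n}`:
`n` minus half the number of blocks `A` with `A ≠ -A`. -/
noncomputable def rankNCB (n : ℕ) (π : Set (Set ℤ)) : ℕ :=
  n - {A | A ∈ π ∧ negSet A ≠ A}.ncard / 2

/-- The inner point set `{±(p+1), …, ±(p+q)}`. -/
def innerSet (p q : ℕ) : Set ℤ := {x : ℤ | (p : ℤ) < |x| ∧ |x| ≤ (p : ℤ) + (q : ℤ)}

/-- The connectivity of `π ∈ NC^B(p,q)`: half the number of blocks `A` with `A ≠ -A`
meeting both `{±1,…,±p}` and `{±(p+1),…,±(p+q)}`. -/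
noncomputable def connectivity (p q : ℕ) (π : Set (Set ℤ)) : ℕ :=
  {A | A ∈ π ∧ negSet A ≠ A ∧ (A ∩ signedSet p).Nonempty ∧
    (A ∩ innerSet p q).Nonempty}.ncard / 2

/-- The number of exterior pairs of blocks `{A, -A}` (with `A ≠ -A`, `A ⊆ {±1,…,±p}`). -/
noncomputable def extPairs (p : ℕ) (π : Set (Set ℤ)) : ℕ :=
  {A | A ∈ π ∧ negSet A ≠ A ∧ A ⊆ signedSet p}.ncard / 2

/-- The number of interior pairs of blocks `{A, -A}`
(with `A ≠ -A`, `A ⊆ {±(p+1),…,±(p+q)}`). -/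
noncomputable def intPairs (p q : ℕ) (π : Set (Set ℤ)) : ℕ :=
  {A | A ∈ π ∧ negSet A ≠ A ∧ A ⊆ innerSet p q}.ncard / 2

/-- The minimum `0̂` of `NC^B(p,q)` (with `n = p+q`): the partition into singletons. -/
def botNCB (n : ℕ) : Set (Set ℤ) := {A | ∃ x ∈ signedSet n, A = {x}}

/-- The maximum `1̂` of `NC^B(p,q)` (with `n = p+q`): the partition with a single block. -/
def topNCB (n : ℕ) : Set (Set ℤ) := {signedSet n}

/-- The orbit of `x` under the subgroup generated by `{τ, γ}`. -/
def jointOrbit (τ γ : Equiv.Perm ℤ) (x : ℤ) : Set ℤ :=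
  {y | ∃ g ∈ Subgroup.closure ({τ, γ} : Set (Equiv.Perm ℤ)), g x = y}

/-- The orbits on `{±1,…,±n}` of the subgroup generated by `{τ, γ}`. -/
def jointOrbitsOn (n : ℕ) (τ γ : Equiv.Perm ℤ) : Set (Set ℤ) :=
  {Y | ∃ x ∈ signedSet n, Y = jointOrbit τ γ x}


set_option linter.unusedSectionVars false
section LinAlg
open Module
variable {V : Type*} [NormedAddCommGroup V] [InnerProductSpace ℝ V] [FiniteDimensional ℝ V]

def LIso (g : V →ₗ[ℝ] V) : Prop := ∀ v w, inner ℝ (g v) (g w) = inner ℝ v w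

def Mov (g : V →ₗ[ℝ] V) : Submodule ℝ V := LinearMap.range (g - 1)

noncomputable def crk (g : V →ₗ[ℝ] V) : ℕ := finrank ℝ (Mov g)

theorem mem_Mov (g : V →ₗ[ℝ] V) (v : V) : g v - v ∈ Mov g := ⟨v, by simp⟩

theorem mem_Mov_iff {g : V →ₗ[ℝ] V} {x : V} : x ∈ Mov g ↔ ∃ v, g v - v = x := by
  simp [Mov, LinearMap.mem_range]

theorem LIso.inj {g : V →ₗ[ℝ] V} (h : LIso g) : Function.Injective g := by
  rw [injective_iff_map_eq_zero]
  intro v hv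
  have := h v v
  rw [hv, inner_zero_left] at this
  exact inner_self_eq_zero.1 this.symm

theorem LIso.surj {g : V →ₗ[ℝ] V} (h : LIso g) : Function.Surjective g :=
  LinearMap.injective_iff_surjective.1 h.inj

theorem LIso.comp {g k : V →ₗ[ℝ] V} (h : LIso g) (h' : LIso k) : LIso (g * k) := by
  intro v w
  simp [h _ _, h' _ _]

theorem fix_iff {g : V →ₗ[ℝ] V} (h : LIso g) (v : V) : g v = v ↔ v ∈ (Mov g)ᗮ := by
  rw [Submodule.mem_orthogonal]
  constructor
  · intro hv u hu
    obtain ⟨w, rfl⟩ := mem_Mov_iff.1 hu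
    rw [inner_sub_left]
    nth_rewrite 1 [← hv]
    rw [h, sub_self]
  · intro hv
    obtain ⟨w, hw⟩ := h.surj v
    have key : ∀ u, inner ℝ u (w - v) = 0 := by
      intro u
      have := hv _ (mem_Mov g u)
      rw [inner_sub_left] at this
      nth_rewrite 1 [← hw] at this
      rw [h] at this
      rw [inner_sub_right]; exact this
    have : w - v = 0 := by
      have := key (w - v)
      exact inner_self_eq_zero.1 this
    rw [sub_eq_zero] at this
    rw [← this, hw, this]

theorem Mov_le_iff {g k : V →ₗ[ℝ] V} (h : LIso g) (h' : LIso k) :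
    Mov g ≤ Mov k ↔ ∀ v, k v = v → g v = v := by
  constructor
  · intro hle v hv
    rw [fix_iff h]; rw [fix_iff h'] at hv
    exact Submodule.orthogonal_le hle hv
  · intro H
    rw [← Submodule.orthogonal_orthogonal (Mov g), ← Submodule.orthogonal_orthogonal (Mov k)]
    apply Submodule.orthogonal_le
    intro v hv
    rw [← fix_iff h'] at hv; rw [← fix_iff h]; exact H v hv

theorem Mov_mul_le (g k : V →ₗ[ℝ] V) : Mov (g * k) ≤ Mov g ⊔ Mov k := by
  intro x hx
  obtain ⟨v, rfl⟩ := mem_Mov_iff.1 hx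
  have : (g * k) v - v = (g (k v) - k v) + (k v - v) := by simp
  rw [this]
  exact Submodule.add_mem_sup (mem_Mov _ _) (mem_Mov _ _)

theorem crk_mul_le (g k : V →ₗ[ℝ] V) : crk (g * k) ≤ crk g + crk k :=
  (Submodule.finrank_mono (Mov_mul_le g k)).trans (Submodule.finrank_add_le_finrank_add_finrank _ _)

theorem red_props {g k : V →ₗ[ℝ] V} (h : crk (g * k) = crk g + crk k) :
    Mov g ≤ Mov (g * k) ∧ Mov g ⊓ Mov k = ⊥ := by
  have h1 := Submodule.finrank_sup_add_finrank_inf_eq (Mov g) (Mov k)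
  have h2 := Submodule.finrank_mono (Mov_mul_le g k)
  unfold crk at h
  have h3 : finrank ℝ ↥(Mov g ⊓ Mov k) = 0 := by omega
  refine ⟨?_, Submodule.finrank_eq_zero.1 h3⟩
  have : Mov (g * k) = Mov g ⊔ Mov k := Submodule.eq_of_le_of_finrank_eq (Mov_mul_le g k) (by omega)
  rw [this]; exact le_sup_left

theorem red_agree {g k : V →ₗ[ℝ] V} (h : crk (g * k) = crk g + crk k) {u : V}
    (hu : (g * k) u - u ∈ Mov g) : g u = (g * k) u := by
  have h2 := (red_props h).2
  have : k u - u ∈ Mov g ⊓ Mov k := by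
    refine ⟨?_, mem_Mov _ _⟩
    have e : k u - u = ((g * k) u - u) - (g (k u) - k u) := by simp
    rw [e]
    exact Submodule.sub_mem _ hu (mem_Mov _ _)
  rw [h2, Submodule.mem_bot, sub_eq_zero] at this
  simp [this]

theorem brady_watt {t s r r1 r2 : V →ₗ[ℝ] V} (ht : LIso t) (hs : LIso s)
    (e : t * r1 = s * r2) (h1 : crk (t * r1) = crk t + crk r1)
    (h2 : crk (s * r2) = crk s + crk r2) (hle : Mov t ≤ Mov (t * r)) (hst : s = t * r) :
    crk s = crk t + crk r := by
  have key : ∀ u, s u - u ∈ Mov t → r u = u := by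
    intro u hu
    obtain ⟨w, hw⟩ := mem_Mov_iff.1 ((red_props h1).1 hu)
    have a1 : t w = (t * r1) w := red_agree h1 (by rw [hw]; exact hu)
    have a2 : s w = (s * r2) w := red_agree h2 (by
      rw [← e, hw, hst]; rw [hst] at hu; exact hle hu)
    have a3 : s (u - w) = u - w := by
      rw [map_sub, a2, ← e]
      rw [sub_eq_sub_iff_sub_eq_sub]
      rw [hw]
    have a4 : t (u - w) = u - w := by
      rw [← hst] at hle
      exact (Mov_le_iff ht hs).1 hle _ a3
    have a5 : t (r u) = t u := by
      have : t u - u = s u - u := by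
        rw [← hw, ← a1, ← sub_eq_zero]
        rw [map_sub] at a4
        have : t u - u - (t w - w) = (t u - t w) - (u - w) := by abel
        rw [this, a4, sub_self]
      have := sub_left_injective this
      rw [this, hst]; rfl
    exact ht.inj a5
  apply le_antisymm
  · rw [hst]; exact crk_mul_le _ _
  · have hle' : Mov t ≤ Mov s := hst ▸ hle
    have hk : (Mov t).comap (s - 1) ≤ LinearMap.ker (r - 1) := by
      intro u hu
      have := key u (by simpa using hu)
      simp [this]
    have d1 := Submodule.finrank_mono hk
    have d2 := LinearMap.finrank_range_add_finrank_ker (r - 1)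
    have d3 := LinearMap.finrank_range_add_finrank_ker (s - 1)
    have d4 := LinearMap.finrank_range_add_finrank_ker ((s - 1).domRestrict ((Mov t).comap (s - 1)))
    have d5 : LinearMap.range ((s - 1).domRestrict ((Mov t).comap (s - 1))) = Mov t := by
      rw [LinearMap.range_domRestrict, Submodule.map_comap_eq]
      exact inf_eq_right.2 hle'
    have d6 : finrank ℝ (LinearMap.ker ((s - 1).domRestrict ((Mov t).comap (s - 1))))
        = finrank ℝ (LinearMap.ker (s - 1)) := by
      rw [LinearMap.ker_domRestrict]
      exact LinearEquiv.finrank_eq (Submodule.comapSubtypeEquivOfLe (by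
        intro x hx
        rw [LinearMap.mem_ker] at hx
        simp only [Submodule.mem_comap]; rw [hx]; exact zero_mem _))
    rw [d5, d6] at d4
    unfold crk Mov
    unfold Mov at d4 d1
    omega

theorem crk_mul_of_disjoint {g k : V →ₗ[ℝ] V} (hg : LIso g) (hk : LIso k)
    (hd : Mov g ⊓ Mov k = ⊥) : crk (g * k) = crk g + crk k := by
  have key : Mov (g * k) = Mov g ⊔ Mov k := by
    apply le_antisymm (Mov_mul_le g k)
    have fixx : ∀ v, (g * k) v = v → g v = v ∧ k v = v := by
      intro v hv
      have hv' : g (k v) = v := hv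
      have : k v - v ∈ Mov g ⊓ Mov k := by
        refine ⟨?_, mem_Mov _ _⟩
        have := mem_Mov g (k v)
        rw [hv'] at this
        have := Submodule.neg_mem _ this
        rwa [neg_sub] at this
      rw [hd, Submodule.mem_bot, sub_eq_zero] at this
      rw [this] at hv'
      exact ⟨hv', this⟩
    apply sup_le
    · exact (Mov_le_iff hg (hg.comp hk)).2 fun v hv => (fixx v hv).1
    · exact (Mov_le_iff hk (hg.comp hk)).2 fun v hv => (fixx v hv).2
  have h1 := Submodule.finrank_sup_add_finrank_inf_eq (Mov g) (Mov k)
  rw [hd] at h1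
  unfold crk
  rw [key]
  simpa using h1

/-- `r` is the reflection with root `a`. -/
def RootRefl (r : V →ₗ[ℝ] V) (a : V) : Prop :=
  a ≠ 0 ∧ r * r = 1 ∧ LIso r ∧ r a = -a ∧ ∀ v, ∃ t : ℝ, r v - v = t • a

theorem RootRefl.mov {r : V →ₗ[ℝ] V} {a : V} (h : RootRefl r a) : Mov r = Submodule.span ℝ {a} := by
  obtain ⟨h0, _, _, h2, h3⟩ := h
  apply le_antisymm
  · intro x hx
    obtain ⟨v, rfl⟩ := mem_Mov_iff.1 hx
    obtain ⟨t, ht⟩ := h3 v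
    rw [ht]
    exact Submodule.smul_mem _ _ (Submodule.mem_span_singleton_self a)
  · rw [Submodule.span_singleton_le_iff_mem]
    rw [mem_Mov_iff]
    refine ⟨(-(1/2) : ℝ) • a, ?_⟩
    rw [map_smul, h2]
    module

theorem RootRefl.crk_one {r : V →ₗ[ℝ] V} {a : V} (h : RootRefl r a) : crk r = 1 := by
  unfold crk
  rw [h.mov]
  exact finrank_span_singleton h.1

theorem RootRefl.down {r s : V →ₗ[ℝ] V} {a : V} (h : RootRefl r a) (hs : LIso s) (ha : a ∈ Mov s) :
    crk (s * r) + 1 = crk s := by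
  have hup : crk s ≤ crk (s * r) + 1 := by
    have := crk_mul_le (s * r) r
    rw [mul_assoc, h.2.1, mul_one, h.crk_one] at this
    exact this
  have hle : Mov (s * r) ≤ Mov s := by
    refine (Mov_mul_le s r).trans (sup_le le_rfl ?_)
    rw [h.mov, Submodule.span_singleton_le_iff_mem]; exact ha
  have hlt : Mov (s * r) < Mov s := by
    refine lt_of_le_of_ne hle ?_
    intro heq
    obtain ⟨w, hw⟩ := mem_Mov_iff.1 ha
    obtain ⟨t, ht⟩ := h.2.2.2.2 (s w)
    have haa : inner ℝ a a ≠ (0 : ℝ) := by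
      intro h'; exact h.1 (inner_self_eq_zero.1 h')
    have hsw : s w = w + a := by rw [← hw]; abel
    have hn : inner ℝ (w + a) (w + a) = (inner ℝ w w : ℝ) := by rw [← hsw]; exact hs w w
    have hr : inner ℝ (r (s w)) (r a) = (inner ℝ (s w) a : ℝ) := h.2.2.1 _ _
    have e1 : r (s w) = w + a + t • a := by rw [← hsw, ← ht]; abel
    rw [e1, h.2.2.2.1, hsw] at hr
    simp only [inner_add_left, inner_add_right, inner_neg_right, inner_smul_left, RCLike.conj_to_real] at hr hn
    rw [real_inner_comm w a] at hn
    have ht1 : t = -1 := by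
      have : (t + 1) * inner ℝ a a = 0 := by linarith
      rcases mul_eq_zero.1 this with h' | h'
      · linarith
      · exact absurd h' haa
    have e2 : r (s w) = w := by rw [e1, ht1]; module
    have e3 : (s * r) (s w) = s w := by
      change s (r (s w)) = s w
      rw [e2]
    have hsr : LIso (s * r) := hs.comp h.2.2.1
    have e4 := (Mov_le_iff hs hsr).1 heq.ge _ e3
    have e5 := hs.inj e4
    rw [e5, sub_self] at hw
    exact h.1 hw.symm
  have := Submodule.finrank_lt_finrank_of_lt hlt
  unfold crk at *
  omega

theorem RootRefl.up {r s : V →ₗ[ℝ] V} {a : V} (h : RootRefl r a) (hs : LIso s) (ha : a ∉ Mov s) :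
    crk (s * r) = crk s + 1 := by
  rw [← h.crk_one]
  apply crk_mul_of_disjoint hs h.2.2.1
  rw [h.mov, eq_bot_iff]
  rintro x ⟨hx, hx'⟩
  obtain ⟨t, rfl⟩ := Submodule.mem_span_singleton.1 hx'
  rw [Submodule.mem_bot]
  by_contra hne
  have ht : t ≠ 0 := by rintro rfl; simp at hne
  exact ha ((Submodule.smul_mem_iff _ ht).1 hx)

end LinAlg


section Rep

abbrev VV (n : ℕ) := EuclideanSpace ℝ (Finset.Icc (1 : ℤ) n)

theorem mem_ss {n : ℕ} {x : ℤ} : x ∈ signedSet n ↔ x ≠ 0 ∧ -(n:ℤ) ≤ x ∧ x ≤ n := by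
  simp [signedSet, abs_le]

theorem neg_mem_ss {n : ℕ} {x : ℤ} : -x ∈ signedSet n ↔ x ∈ signedSet n := by
  simp [signedSet]

/-- odd extension -/
noncomputable def ev {n : ℕ} (v : VV n) (x : ℤ) : ℝ :=
  if h : 1 ≤ x ∧ x ≤ n then v ⟨x, Finset.mem_Icc.2 h⟩
  else if h : 1 ≤ -x ∧ -x ≤ n then - v ⟨-x, Finset.mem_Icc.2 h⟩ else 0

theorem ev_coe {n : ℕ} (v : VV n) (i : Finset.Icc (1:ℤ) n) : ev v i = v i := by
  have := Finset.mem_Icc.1 i.2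
  simp [ev, this]

theorem ev_neg {n : ℕ} (v : VV n) (x : ℤ) : ev v (-x) = - ev v x := by
  unfold ev
  by_cases h1 : 1 ≤ x ∧ x ≤ n
  · have h2 : ¬ (1 ≤ -x ∧ -x ≤ n) := by omega
    rw [dif_neg h2, dif_pos h1, dif_pos (by simpa using h1)]
    simp
  · by_cases h2 : (1 ≤ -x ∧ -x ≤ n)
    · rw [dif_neg h1, dif_pos h2, dif_pos h2]; simp
    · rw [dif_neg h1, dif_neg h2, dif_neg h2, dif_neg (by simpa using h1)]; simp

theorem ev_out {n : ℕ} (v : VV n) {x : ℤ} (hx : x ∉ signedSet n) : ev v x = 0 := by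
  rw [mem_ss] at hx
  unfold ev
  rw [dif_neg (by omega), dif_neg (by omega)]

theorem ev_ext {n : ℕ} {v w : VV n} (h : ∀ x ∈ signedSet n, ev v x = ev w x) : v = w := by
  ext i
  rw [← ev_coe, ← ev_coe]
  apply h
  have := Finset.mem_Icc.1 i.2
  rw [mem_ss]; omega

theorem ev_add {n : ℕ} (v w : VV n) (x : ℤ) : ev (v + w) x = ev v x + ev w x := by
  unfold ev; split_ifs <;> simp; ring

theorem ev_smul {n : ℕ} (t : ℝ) (v : VV n) (x : ℤ) : ev (t • v) x = t * ev v x := by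
  unfold ev; split_ifs <;> simp

theorem ev_sub {n : ℕ} (v w : VV n) (x : ℤ) : ev (v - w) x = ev v x - ev w x := by
  unfold ev; split_ifs <;> simp; ring

noncomputable def act (n : ℕ) (σ : Equiv.Perm ℤ) : VV n →ₗ[ℝ] VV n where
  toFun v := WithLp.toLp 2 (fun i => ev v (σ⁻¹ i))
  map_add' v w := by ext i; simp [ev_add]
  map_smul' t v := by ext i; simp [ev_smul]

theorem inB_one (n : ℕ) : inB n 1 := ⟨by simp, by simp⟩

theorem inB.maps {n : ℕ} {σ : Equiv.Perm ℤ} (h : inB n σ) {x : ℤ} :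
    σ x ∈ signedSet n ↔ x ∈ signedSet n := by
  constructor
  · intro hx
    by_contra hc
    rw [h.2 x hc] at hx; exact hc hx
  · intro hx
    by_contra hc
    have := h.2 _ hc
    have := σ.injective this
    rw [this] at hc; exact hc hx

theorem inB.inv {n : ℕ} {σ : Equiv.Perm ℤ} (h : inB n σ) : inB n σ⁻¹ := by
  constructor
  · intro x
    rw [Equiv.Perm.inv_eq_iff_eq, h.1]; simp
  · intro x hx
    rw [Equiv.Perm.inv_eq_iff_eq, h.2 x hx]

theorem inB.mul {n : ℕ} {σ τ : Equiv.Perm ℤ} (h : inB n σ) (h' : inB n τ) : inB n (σ * τ) := by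
  constructor
  · intro x
    simp [h.1, h'.1]
  · intro x hx
    simp [h.2 x hx, h'.2 x hx]

theorem inB.mono {n m : ℕ} (hmn : m ≤ n) {σ : Equiv.Perm ℤ} (h : inB m σ) : inB n σ := by
  refine ⟨h.1, fun x hx => h.2 x ?_⟩
  rw [mem_ss] at *
  omega

theorem ev_act {n : ℕ} {σ : Equiv.Perm ℤ} (h : inB n σ) (v : VV n) (x : ℤ) :
    ev (act n σ v) x = ev v (σ⁻¹ x) := by
  by_cases h1 : 1 ≤ x ∧ x ≤ n
  · have := ev_coe (act n σ v) ⟨x, Finset.mem_Icc.2 h1⟩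
    rw [this]; rfl
  · by_cases h2 : (1 ≤ -x ∧ -x ≤ n)
    · have := ev_coe (act n σ v) ⟨-x, Finset.mem_Icc.2 h2⟩
      have h3 : ev (act n σ v) (-x) = ev v (σ⁻¹ (-x)) := by rw [this]; rfl
      rw [h.inv.1, ev_neg, ev_neg] at h3
      linarith
    · have hx : x ∉ signedSet n := by rw [mem_ss]; omega
      rw [ev_out _ hx, h.inv.2 _ hx, ev_out _ hx]

theorem act_mul {n : ℕ} {σ τ : Equiv.Perm ℤ} (h : inB n σ) (h' : inB n τ) :
    act n (σ * τ) = act n σ * act n τ := by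
  apply LinearMap.ext
  intro v
  apply ev_ext
  intro x _
  rw [ev_act (h.mul h'), Module.End.mul_apply, ev_act h, ev_act h']
  simp

theorem act_one (n : ℕ) : act n 1 = 1 := by
  apply LinearMap.ext
  intro v
  apply ev_ext
  intro x _
  rw [ev_act (inB_one n)]
  simp

theorem inner_ev {n : ℕ} (v w : VV n) :
    2 * inner ℝ v w = ∑ x ∈ Finset.Icc (-(n:ℤ)) n, ev v x * ev w x := by
  have h1 : inner ℝ v w = ∑ x ∈ Finset.Icc (1:ℤ) n, ev v x * ev w x := by
    rw [PiLp.inner_apply, ← Finset.sum_coe_sort (Finset.Icc (1:ℤ) n)]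
    apply Finset.sum_congr rfl
    intro i _
    rw [ev_coe, ev_coe]; simp [mul_comm]
  have h2 : ∑ x ∈ Finset.Icc (1:ℤ) n, ev v x * ev w x
      = ∑ x ∈ Finset.Icc (-(n:ℤ)) (-1), ev v x * ev w x := by
    apply Finset.sum_nbij' (fun x => -x) (fun x => -x)
    · intro x hx; rw [Finset.mem_Icc] at *; omega
    · intro x hx; rw [Finset.mem_Icc] at *; omega
    · simp
    · simp
    · intro x _; rw [ev_neg, ev_neg]; ring
  have h3 : Finset.Icc (-(n:ℤ)) n = insert 0 (Finset.Icc (1:ℤ) n ∪ Finset.Icc (-(n:ℤ)) (-1)) := by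
    ext x; simp only [Finset.mem_Icc, Finset.mem_insert, Finset.mem_union]; omega
  rw [h3, Finset.sum_insert, Finset.sum_union, ← h2, ← h1, ev_out v (x := 0)]
  · ring
  · simp [mem_ss]
  · rw [Finset.disjoint_left]; intro x; simp only [Finset.mem_Icc]; omega
  · simp

theorem act_liso {n : ℕ} {σ : Equiv.Perm ℤ} (h : inB n σ) : LIso (act n σ) := by
  intro v w
  have : 2 * inner ℝ (act n σ v) (act n σ w) = 2 * inner ℝ v w := by
    rw [inner_ev, inner_ev]
    have maps : ∀ τ, inB n τ → ∀ x ∈ Finset.Icc (-(n:ℤ)) n, τ x ∈ Finset.Icc (-(n:ℤ)) n := by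
      intro τ hτ x hx
      rw [Finset.mem_Icc] at *
      by_cases hx0 : x ∈ signedSet n
      · have := (mem_ss.1 (hτ.maps.2 hx0)); omega
      · rw [hτ.2 x hx0]; exact hx
    apply Finset.sum_nbij' (fun x => σ⁻¹ x) (fun x => σ x)
    · exact maps _ h.inv
    · exact maps _ h
    · simp
    · simp
    · intro x _
      rw [ev_act h, ev_act h]
  linarith

noncomputable def ee (n : ℕ) (x : ℤ) : VV n :=
  WithLp.toLp 2 (fun i => (if (i:ℤ) = x then 1 else 0) - (if (i:ℤ) = -x then 1 else 0))

theorem ev_ee {n : ℕ} (x : ℤ) {y : ℤ} (hy : y ∈ signedSet n) :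
    ev (ee n x) y = (if y = x then 1 else 0) - (if y = -x then 1 else 0) := by
  rw [mem_ss] at hy
  unfold ev
  by_cases h1 : 1 ≤ y ∧ y ≤ n
  · rw [dif_pos h1]; rfl
  · rw [dif_neg h1, dif_pos (by omega)]
    have e1 : (-y = x) ↔ (y = -x) := by omega
    have e2 : (-y = -x) ↔ (y = x) := by omega
    simp only [ee, e1, e2]
    ring

theorem inner_ee {n : ℕ} (x : ℤ) (v : VV n) : inner ℝ (ee n x) v = ev v x := by
  have h1 : inner ℝ (ee n x) v = ∑ i ∈ Finset.Icc (1:ℤ) n,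
      ((if (i:ℤ) = x then 1 else 0) - (if (i:ℤ) = -x then 1 else 0)) * ev v i := by
    rw [PiLp.inner_apply, ← Finset.sum_coe_sort (Finset.Icc (1:ℤ) n)]
    apply Finset.sum_congr rfl
    intro i _
    rw [ev_coe]; simp [ee, mul_comm]
  rw [h1]
  simp only [sub_mul, ite_mul, one_mul, zero_mul, Finset.sum_sub_distrib, Finset.sum_ite_eq',
    Finset.mem_Icc]
  by_cases h1 : 1 ≤ x ∧ x ≤ n
  · rw [if_pos h1, if_neg (by omega)]; simp
  · by_cases h2 : 1 ≤ -x ∧ -x ≤ n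
    · rw [if_neg h1, if_pos h2, ev_neg]; simp
    · rw [if_neg h1, if_neg h2, ev_out]; · simp
      rw [mem_ss]; omega

theorem act_ee {n : ℕ} {σ : Equiv.Perm ℤ} (h : inB n σ) (x : ℤ) :
    act n σ (ee n x) = ee n (σ x) := by
  apply ev_ext
  intro y hy
  rw [ev_act h, ev_ee _ (h.inv.maps.2 hy), ev_ee _ hy]
  simp only [Equiv.Perm.inv_eq_iff_eq, h.1]

theorem ee_inj {n : ℕ} {x y : ℤ} (hx : x ∈ signedSet n) (h : ee n x = ee n y) : x = y := by
  have := ev_ee (n := n) x hx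
  rw [h, ev_ee _ hx] at this
  have h0 := (mem_ss.1 hx).1
  by_contra hne
  rw [if_neg hne, if_pos rfl, if_neg (show x ≠ -x by omega)] at this
  split_ifs at this <;> norm_num at this

def bref (m x : ℤ) : Equiv.Perm ℤ :=
  if x = -m then Equiv.swap m x else Equiv.swap m x * Equiv.swap (-m) (-x)

theorem bref_apply {m x : ℤ} (hm : m ≠ 0) (hx : x ≠ 0) (y : ℤ) :
    bref m x y = if y = m then x else if y = x then m else if y = -m then -x
      else if y = -x then -m else y := by
  unfold bref
  split_ifs with h1
  all_goals simp only [Equiv.Perm.mul_apply, Equiv.swap_apply_def]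
  all_goals split_ifs
  all_goals omega

theorem bref_self {m : ℤ} (hm : m ≠ 0) : bref m m = 1 := by
  unfold bref
  rw [if_neg (by omega)]; simp; rfl

theorem bref_mul_self {m x : ℤ} (hm : m ≠ 0) (hx : x ≠ 0) : bref m x * bref m x = 1 := by
  ext y
  simp only [Equiv.Perm.mul_apply, bref_apply hm hx, Equiv.Perm.one_apply]
  split_ifs <;> omega

theorem bref_inv {m x : ℤ} (hm : m ≠ 0) (hx : x ≠ 0) : (bref m x)⁻¹ = bref m x := by
  rw [inv_eq_iff_mul_eq_one, bref_mul_self hm hx]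

theorem bref_inB {n : ℕ} {m x : ℤ} (hm : m ∈ signedSet n) (hx : x ∈ signedSet n) :
    inB n (bref m x) := by
  have hm' := mem_ss.1 hm
  have hx' := mem_ss.1 hx
  constructor
  · intro y
    rw [bref_apply hm'.1 hx'.1, bref_apply hm'.1 hx'.1]
    split_ifs <;> omega
  · intro y hy
    rw [mem_ss] at hy
    rw [bref_apply hm'.1 hx'.1]
    split_ifs <;> omega

theorem bref_root {n : ℕ} {m x : ℤ} (hm : m ∈ signedSet n) (hx : x ∈ signedSet n) (hne : m ≠ x) :
    RootRefl (act n (bref m x)) (ee n m - ee n x) := by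
  have hm0 := (mem_ss.1 hm).1
  have hx0 := (mem_ss.1 hx).1
  have hB := bref_inB hm hx
  refine ⟨?_, ?_, act_liso hB, ?_, ?_⟩
  · rw [sub_ne_zero]; intro h; exact hne (ee_inj hm h)
  · rw [← act_mul hB hB, bref_mul_self hm0 hx0, act_one]
  · rw [map_sub, act_ee hB, act_ee hB, bref_apply hm0 hx0, bref_apply hm0 hx0, if_pos rfl,
      if_neg hne.symm, if_pos rfl, neg_sub]
  · intro v
    refine ⟨if x = -m then - ev v m else ev v x - ev v m, ?_⟩
    apply ev_ext
    intro y hy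
    rw [ev_sub, ev_act hB, bref_inv hm0 hx0, ev_smul, ev_sub, ev_ee _ hy, ev_ee _ hy,
      bref_apply hm0 hx0]
    by_cases h1 : x = -m
    · subst h1
      simp only [neg_neg, if_true]
      by_cases ha : y = m
      · subst ha
        have : y ≠ -y := by omega
        simp [this, ev_neg]; ring
      · by_cases hb : y = -m
        · subst hb
          have : -m ≠ m := by omega
          simp [this, ev_neg]; ring
        · simp [ha, hb]
    · rw [if_neg h1]
      by_cases ha : y = m
      · subst ha
        have t1 : y ≠ -y := by omega
        have t2 : y ≠ -x := by omega
        simp [t1, t2, hne]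
      · by_cases hb : y = x
        · subst hb
          have t1 : y ≠ -y := by omega
          simp [ha, h1, t1]
        · by_cases hc : y = -m
          · subst hc
            have t2 : m ≠ x := hne
            simp [ha, hb, t2, ev_neg]; ring
          · by_cases hd : y = -x
            · subst hd
              simp [ha, hb, hc, ev_neg]; ring
            · simp [ha, hb, hc, hd]

noncomputable def cc (n : ℕ) (σ : Equiv.Perm ℤ) : ℕ := crk (act n σ)

theorem cc_mul_le {n : ℕ} {σ τ : Equiv.Perm ℤ} (h : inB n σ) (h' : inB n τ) :
    cc n (σ * τ) ≤ cc n σ + cc n τ := by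
  unfold cc; rw [act_mul h h']; exact crk_mul_le _ _

theorem cc_one (n : ℕ) : cc n 1 = 0 := by
  unfold cc crk Mov
  rw [act_one, sub_self, LinearMap.range_zero]; simp

theorem cc_eq_zero {n : ℕ} {σ : Equiv.Perm ℤ} (h : inB n σ) (h0 : cc n σ = 0) : σ = 1 := by
  unfold cc crk at h0
  rw [Submodule.finrank_eq_zero] at h0
  ext x
  by_cases hx : x ∈ signedSet n
  · have := mem_Mov (act n σ) (ee n x)
    rw [h0, Submodule.mem_bot, sub_eq_zero, act_ee h] at this
    simpa using ee_inj (h.maps.2 hx) this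
  · simpa using h.2 x hx

theorem cc_bref {n : ℕ} {m x : ℤ} (hm : m ∈ signedSet n) (hx : x ∈ signedSet n) (hne : m ≠ x) :
    cc n (bref m x) = 1 := (bref_root hm hx hne).crk_one

theorem cc_bref_down {n : ℕ} {σ : Equiv.Perm ℤ} (h : inB n σ) {m x : ℤ}
    (hm : m ∈ signedSet n) (hx : x ∈ signedSet n) (hne : m ≠ x) :
    cc n (σ * bref m x) + 1 = cc n σ ↔ ∀ v, act n σ v = v → ev v m = ev v x := by
  have hr := bref_root hm hx hne
  have key : ee n m - ee n x ∈ Mov (act n σ) ↔ ∀ v, act n σ v = v → ev v m = ev v x := by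
    rw [← Submodule.orthogonal_orthogonal (Mov (act n σ)), Submodule.mem_orthogonal]
    simp only [← fix_iff (act_liso h)]
    apply forall_congr'
    intro v
    rw [real_inner_comm, inner_sub_left, inner_ee, inner_ee, sub_eq_zero]
  rw [← key]
  unfold cc
  rw [act_mul h (bref_inB hm hx)]
  constructor
  · intro h'
    by_contra hc
    have := hr.up (act_liso h) hc
    omega
  · exact hr.down (act_liso h)

theorem gen_iff {n : ℕ} {g : Equiv.Perm ℤ} : g ∈ genB n ↔
    ∃ m x, m ∈ signedSet n ∧ x ∈ signedSet n ∧ m ≠ x ∧ g = bref m x := by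
  have sc : ∀ a b c d : ℤ, a ≠ c → a ≠ d → b ≠ c → b ≠ d →
      Equiv.swap a b * Equiv.swap c d = Equiv.swap c d * Equiv.swap a b := by
    intro a b c d h1 h2 h3 h4
    apply Equiv.Perm.Disjoint.commute
    intro x
    simp only [Equiv.swap_apply_def]
    split_ifs <;> simp_all
  constructor
  · rintro (⟨i, j, h1, h2, h3, h4, h5, rfl⟩ | ⟨i, j, h1, h2, h3, h4, h5, rfl⟩ | ⟨i, h1, h2, rfl⟩)
    · refine ⟨i, j, by rw [mem_ss]; omega, by rw [mem_ss]; omega, h5, ?_⟩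
      rw [bref, if_neg (by omega)]
    · refine ⟨i, -j, by rw [mem_ss]; omega, by rw [mem_ss]; omega, by omega, ?_⟩
      rw [bref, if_neg (by omega), neg_neg]
    · refine ⟨i, -i, by rw [mem_ss]; omega, by rw [mem_ss]; omega, by omega, ?_⟩
      rw [bref, if_pos rfl]
  · rintro ⟨m, x, hm, hx, hne, rfl⟩
    rw [mem_ss] at hm hx
    unfold bref
    by_cases h : x = -m
    · rw [if_pos h]
      right; right
      by_cases h0 : 0 < m
      · exact ⟨m, by omega, by omega, by rw [h]⟩
      · exact ⟨x, by omega, by omega, by rw [h, neg_neg, Equiv.swap_comm]⟩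
    · rw [if_neg h]
      by_cases hm0 : 0 < m <;> by_cases hx0 : 0 < x
      · left; exact ⟨m, x, by omega, by omega, by omega, by omega, hne, rfl⟩
      · right; left; exact ⟨m, -x, by omega, by omega, by omega, by omega, by omega, by rw [neg_neg]⟩
      · right; left; refine ⟨-m, x, by omega, by omega, by omega, by omega, by omega, ?_⟩
        rw [neg_neg, sc _ _ _ _ (by omega) (by omega) (by omega) (by omega)]
      · left; refine ⟨-m, -x, by omega, by omega, by omega, by omega, by omega, ?_⟩
        rw [neg_neg, neg_neg, sc _ _ _ _ (by omega) (by omega) (by omega) (by omega)]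

theorem lenB_eq {n : ℕ} {σ : Equiv.Perm ℤ} (h : inB n σ) : lenB n σ = cc n σ := by
  have lower : ∀ l : List (Equiv.Perm ℤ), (∀ g ∈ l, g ∈ genB n) →
      inB n l.prod ∧ cc n l.prod ≤ l.length := by
    intro l
    induction l with
    | nil => intro _; exact ⟨inB_one n, by simp [cc_one]⟩
    | cons a t ih =>
      intro hl
      obtain ⟨h1, h2⟩ := ih fun g hg => hl g (by simp [hg])
      obtain ⟨m, x, hm, hx, hne, rfl⟩ := gen_iff.1 (hl a (by simp))
      have hB := bref_inB hm hx
      rw [List.prod_cons]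
      refine ⟨hB.mul h1, ?_⟩
      have := cc_mul_le hB h1
      rw [cc_bref hm hx hne] at this
      simp only [List.length_cons]; omega
  have upper : ∀ k, ∀ σ, inB n σ → cc n σ = k → ∃ l : List (Equiv.Perm ℤ), l.length = k ∧
      (∀ g ∈ l, g ∈ genB n) ∧ l.prod = σ := by
    intro k
    induction k with
    | zero =>
      intro σ hσ h0
      exact ⟨[], rfl, by simp, by rw [cc_eq_zero hσ h0]; rfl⟩
    | succ k ih =>
      intro σ hσ hk
      have hne : σ ≠ 1 := by rintro rfl; rw [cc_one] at hk; omega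
      obtain ⟨m, hm⟩ : ∃ m, σ m ≠ m := by
        by_contra hc; push Not at hc; exact hne (Equiv.ext hc)
      have hms : m ∈ signedSet n := by by_contra hc; exact hm (hσ.2 m hc)
      have hd := (cc_bref_down hσ hms (hσ.maps.2 hms) hm.symm).2 (by
        intro v hv
        have := ev_act hσ v (σ m)
        rw [hv] at this; simpa using this.symm)
      have hB := bref_inB hms (hσ.maps.2 hms)
      obtain ⟨l, h1, h2, h3⟩ := ih (σ * bref m (σ m)) (hσ.mul hB) (by omega)
      refine ⟨l ++ [bref m (σ m)], by simp [h1], ?_, ?_⟩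
      · intro g hg
        rw [List.mem_append, List.mem_singleton] at hg
        rcases hg with hg | rfl
        · exact h2 g hg
        · exact gen_iff.2 ⟨m, σ m, hms, hσ.maps.2 hms, hm.symm, rfl⟩
      · rw [List.prod_append, h3, List.prod_singleton, mul_assoc,
          bref_mul_self (mem_ss.1 hms).1 (mem_ss.1 (hσ.maps.2 hms)).1, mul_one]
  apply le_antisymm
  · exact Nat.sInf_le (upper _ σ h rfl)
  · refine le_csInf ⟨_, upper _ σ h rfl⟩ ?_
    intro k hk
    obtain ⟨l, h0, h1, h2⟩ := hk
    rw [← h0, ← h2]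
    exact (lower l h1).2

end Rep


section Order
open Equiv.Perm

def RR (σ : Equiv.Perm ℤ) (x y : ℤ) : Prop :=
  SameCycle σ x y ∨ (SameCycle σ x (-x) ∧ SameCycle σ y (-y))

theorem inB.zpow {n : ℕ} {σ : Equiv.Perm ℤ} (h : inB n σ) (k : ℤ) : inB n (σ ^ k) := by
  induction k with
  | zero => exact inB_one n
  | succ k ih => rw [zpow_add_one]; exact ih.mul h
  | pred k ih => rw [zpow_sub_one]; exact ih.mul h.inv

theorem sc_neg {n : ℕ} {σ : Equiv.Perm ℤ} (h : inB n σ) {x y : ℤ} :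
    SameCycle σ (-x) (-y) ↔ SameCycle σ x y := by
  apply exists_congr
  intro k
  rw [(h.zpow k).1, neg_inj]

theorem sc_mem {n : ℕ} {σ : Equiv.Perm ℤ} (h : inB n σ) {x y : ℤ} (hs : SameCycle σ x y) :
    y ∈ signedSet n ↔ x ∈ signedSet n := by
  obtain ⟨k, rfl⟩ := hs
  exact (h.zpow k).maps

theorem ev_zpow {n : ℕ} {σ : Equiv.Perm ℤ} (h : inB n σ) {v : VV n} (hv : act n σ v = v) (x : ℤ) :
    ev v (σ x) = ev v x := by
  have := ev_act h v (σ x)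
  rw [hv] at this; simpa using this

theorem ev_sc {n : ℕ} {σ : Equiv.Perm ℤ} (h : inB n σ) {v : VV n} (hv : act n σ v = v) {x y : ℤ}
    (hs : SameCycle σ x y) : ev v x = ev v y := by
  obtain ⟨k, rfl⟩ := hs
  induction k with
  | zero => rfl
  | succ k ih => rw [add_comm, zpow_add, zpow_one, mul_apply, ev_zpow h hv]; exact ih
  | pred k ih =>
    rw [ih, sub_eq_add_neg, add_comm, zpow_add, mul_apply, zpow_neg_one]
    rw [← ev_zpow h hv (σ⁻¹ _)]
    simp

open Classical in
theorem RR_iff {n : ℕ} {σ : Equiv.Perm ℤ} (h : inB n σ) {x y : ℤ} (hx : x ∈ signedSet n)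
    (hy : y ∈ signedSet n) :
    RR σ x y ↔ ∀ v : VV n, act n σ v = v → ev v x = ev v y := by
  constructor
  · rintro (hs | ⟨h1, h2⟩) v hv
    · exact ev_sc h hv hs
    · have e1 := ev_sc h hv h1
      have e2 := ev_sc h hv h2
      rw [ev_neg] at e1 e2
      linarith
  · intro H
    -- orbit vectors
    have key : ∀ a : ℤ, ∃ v : VV n, act n σ v = v ∧ ∀ b ∈ signedSet n, ev v b =
        (if SameCycle σ a b then 1 else 0) - (if SameCycle σ (-a) b then 1 else 0) := by
      intro a
      let v : VV n := WithLp.toLp 2 (fun i => (if SameCycle σ a i then 1 else 0)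
        - (if SameCycle σ (-a) i then 1 else 0))
      have hv : ∀ b ∈ signedSet n, ev v b =
        (if SameCycle σ a b then 1 else 0) - (if SameCycle σ (-a) b then 1 else 0) := by
        intro b hb
        rw [mem_ss] at hb
        unfold ev
        by_cases h1 : 1 ≤ b ∧ b ≤ n
        · rw [dif_pos h1]
        · rw [dif_neg h1, dif_pos (by omega)]
          have e1 : SameCycle σ a (-b) ↔ SameCycle σ (-a) b := by
            rw [← sc_neg h, neg_neg]
          have e2 : SameCycle σ (-a) (-b) ↔ SameCycle σ a b := sc_neg h
          simp only [v, e1, e2]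
          ring
      refine ⟨v, ?_, hv⟩
      apply ev_ext
      intro b hb
      rw [ev_act h, hv _ (h.inv.maps.2 hb), hv _ hb]
      simp
    by_cases hxx : SameCycle σ x (-x)
    · by_cases hyy : SameCycle σ y (-y)
      · right; exact ⟨hxx, hyy⟩
      · left
        obtain ⟨v, hv, hv'⟩ := key y
        have := H v hv
        rw [hv' x hx, hv' y hy, if_pos (SameCycle.refl σ y), if_neg (show ¬ SameCycle σ (-y) y from fun hc => hyy hc.symm)] at this
        by_contra hc
        rw [if_neg (show ¬ SameCycle σ y x from fun h' => hc h'.symm)] at this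
        split_ifs at this <;> norm_num at this
    · left
      obtain ⟨v, hv, hv'⟩ := key x
      have := H v hv
      rw [hv' x hx, hv' y hy, if_pos (SameCycle.refl σ x), if_neg (fun hc => hxx hc.symm)] at this
      by_contra hc
      rw [if_neg hc] at this
      split_ifs at this <;> norm_num at this

theorem RR_mem {n : ℕ} {σ : Equiv.Perm ℤ} (h : inB n σ) {x y : ℤ} (hx : x ∈ signedSet n)
    (hr : RR σ x y) (hy0 : y ≠ 0) : y ∈ signedSet n := by
  rcases hr with hs | ⟨_, h2⟩
  · exact (sc_mem h hs).2 hx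
  · by_contra hc
    obtain ⟨k, hk⟩ := h2
    rw [(h.zpow k).2 y hc] at hk
    omega

theorem permOrbit_eq (σ : Equiv.Perm ℤ) (x : ℤ) : permOrbit σ x = {y | SameCycle σ x y} := rfl

theorem negOrbit_iff {n : ℕ} {σ : Equiv.Perm ℤ} (h : inB n σ) (x : ℤ) :
    negSet (permOrbit σ x) = permOrbit σ x ↔ SameCycle σ x (-x) := by
  constructor
  · intro he
    have : x ∈ negSet (permOrbit σ x) := by rw [he]; exact SameCycle.refl σ x
    exact this
  · intro hs
    ext y
    change SameCycle σ x (-y) ↔ SameCycle σ x y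
    rw [← sc_neg h, neg_neg]
    exact ⟨fun h' => hs.trans h', fun h' => hs.symm.trans h'⟩

theorem mem_omega {n : ℕ} {σ : Equiv.Perm ℤ} (h : inB n σ) (A : Set ℤ) :
    A ∈ omegaTilde n σ ↔ ∃ x ∈ signedSet n, A = {y | y ∈ signedSet n ∧ RR σ x y} := by
  have hz : ∀ x ∈ signedSet n, SameCycle σ x (-x) →
      ⋃₀ {A | A ∈ orbitsOn n σ ∧ negSet A = A} = {y | y ∈ signedSet n ∧ RR σ x y} := by
    intro x hx hxx
    ext y
    simp only [Set.mem_sUnion, Set.mem_ofPred_eq]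
    constructor
    · rintro ⟨B, ⟨⟨z, hz, rfl⟩, hB⟩, hy⟩
      rw [negOrbit_iff h] at hB
      have hy' : SameCycle σ z y := hy
      refine ⟨(sc_mem h hy').2 hz, Or.inr ⟨hxx, ?_⟩⟩
      exact hy'.symm.trans (hB.trans ((sc_neg h).2 hy'))
    · rintro ⟨hy, hr⟩
      refine ⟨permOrbit σ y, ⟨⟨y, hy, rfl⟩, ?_⟩, SameCycle.refl σ y⟩
      rw [negOrbit_iff h]
      rcases hr with hs | ⟨_, h2⟩
      · exact hs.symm.trans (hxx.trans ((sc_neg h).2 hs))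
      · exact h2
  constructor
  · rintro (⟨⟨x, hx, rfl⟩, hne⟩ | ⟨rfl, hne⟩)
    · refine ⟨x, hx, ?_⟩
      rw [Ne, negOrbit_iff h] at hne
      ext y
      constructor
      · intro hy; exact ⟨(sc_mem h hy).2 hx, Or.inl hy⟩
      · rintro ⟨_, hs | ⟨h1, _⟩⟩
        · exact hs
        · exact absurd h1 hne
    · obtain ⟨y, B, ⟨⟨z, hz', rfl⟩, hB⟩, hy⟩ := hne
      refine ⟨z, hz', hz z hz' ((negOrbit_iff h z).1 hB)⟩
  · rintro ⟨x, hx, rfl⟩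
    by_cases hxx : SameCycle σ x (-x)
    · right
      refine ⟨(hz x hx hxx).symm, ⟨x, hx, Or.inl (SameCycle.refl σ x)⟩⟩
    · left
      have : {y | y ∈ signedSet n ∧ RR σ x y} = permOrbit σ x := by
        ext y
        constructor
        · rintro ⟨_, hs | ⟨h1, _⟩⟩
          · exact hs
          · exact absurd h1 hxx
        · intro hy; exact ⟨(sc_mem h hy).2 hx, Or.inl hy⟩
      rw [this]
      refine ⟨⟨x, hx, rfl⟩, ?_⟩
      rw [Ne, negOrbit_iff h]; exact hxx

theorem refines_iff {n : ℕ} {τ σ : Equiv.Perm ℤ} (h : inB n τ) (h' : inB n σ) :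
    refines (omegaTilde n τ) (omegaTilde n σ) ↔ ∀ v : VV n, act n σ v = v → act n τ v = v := by
  constructor
  · intro H v hv
    apply ev_ext
    intro x hx
    rw [ev_act h]
    obtain ⟨B, hB, hsub⟩ := H _ ((mem_omega h _).2 ⟨x, hx, rfl⟩)
    obtain ⟨z, hz, rfl⟩ := (mem_omega h' _).1 hB
    have h1 := hsub (show x ∈ _ from ⟨hx, Or.inl (SameCycle.refl τ x)⟩)
    have h2 := hsub (show τ⁻¹ x ∈ _ from ⟨h.inv.maps.2 hx, Or.inl ⟨-1, by simp⟩⟩)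
    rw [← (RR_iff h' hz h1.1).1 h1.2 v hv, ← (RR_iff h' hz h2.1).1 h2.2 v hv]
  · intro H A hA
    obtain ⟨x, hx, rfl⟩ := (mem_omega h _).1 hA
    refine ⟨_, (mem_omega h' _).2 ⟨x, hx, rfl⟩, ?_⟩
    rintro y ⟨hy, hr⟩
    refine ⟨hy, (RR_iff h' hx hy).2 fun v hv => (RR_iff h hx hy).1 hr v (H v hv)⟩

theorem leB_iff {n : ℕ} {τ σ : Equiv.Perm ℤ} (h : inB n τ) (h' : inB n σ) :
    leB n τ σ ↔ cc n σ = cc n τ + cc n (τ⁻¹ * σ) := by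
  unfold leB
  rw [lenB_eq h, lenB_eq h', lenB_eq (h.inv.mul h')]

theorem leB_mov {n : ℕ} {τ σ : Equiv.Perm ℤ} (h : inB n τ) (h' : inB n σ) (hl : leB n τ σ) :
    Mov (act n τ) ≤ Mov (act n σ) := by
  rw [leB_iff h h'] at hl
  have e : act n σ = act n τ * act n (τ⁻¹ * σ) := by
    rw [← act_mul h (h.inv.mul h')]; simp
  unfold cc at hl
  nth_rewrite 1 [e] at hl
  rw [e]
  exact (red_props hl).1

theorem leB_iff_refines {n : ℕ} {τ σ γ : Equiv.Perm ℤ} (hτ : inB n τ) (hσ : inB n σ)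
    (hγ : inB n γ) (h1 : leB n τ γ) (h2 : leB n σ γ) :
    leB n τ σ ↔ refines (omegaTilde n τ) (omegaTilde n σ) := by
  rw [refines_iff hτ hσ, ← Mov_le_iff (act_liso hτ) (act_liso hσ)]
  refine ⟨leB_mov hτ hσ, ?_⟩
  intro hle
  rw [leB_iff hτ hγ] at h1
  rw [leB_iff hσ hγ] at h2
  rw [leB_iff hτ hσ]
  have e1 : act n γ = act n τ * act n (τ⁻¹ * γ) := by
    rw [← act_mul hτ (hτ.inv.mul hγ)]; simp
  have e2 : act n γ = act n σ * act n (σ⁻¹ * γ) := by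
    rw [← act_mul hσ (hσ.inv.mul hγ)]; simp
  have e3 : act n σ = act n τ * act n (τ⁻¹ * σ) := by
    rw [← act_mul hτ (hτ.inv.mul hσ)]; simp
  unfold cc at h1 h2 ⊢
  nth_rewrite 1 [e1] at h1
  nth_rewrite 1 [e2] at h2
  exact brady_watt (act_liso hτ) (act_liso hσ) (e1.symm.trans e2) h1 h2 (e3 ▸ hle) e3

theorem leB_trans {n : ℕ} {τ σ γ : Equiv.Perm ℤ} (hτ : inB n τ) (hσ : inB n σ)
    (hγ : inB n γ) (h1 : leB n τ σ) (h2 : leB n σ γ) : leB n τ γ := by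
  rw [leB_iff hτ hσ] at h1
  rw [leB_iff hσ hγ] at h2
  rw [leB_iff hτ hγ]
  have a := cc_mul_le hτ (hτ.inv.mul hγ)
  have b := cc_mul_le (hτ.inv.mul hσ) (hσ.inv.mul hγ)
  rw [show τ * (τ⁻¹ * γ) = γ by group] at a
  rw [show τ⁻¹ * σ * (σ⁻¹ * γ) = τ⁻¹ * γ by group] at b
  omega

theorem leB_refl {n : ℕ} {σ : Equiv.Perm ℤ} (hσ : inB n σ) : leB n σ σ := by
  rw [leB_iff hσ hσ]; simp [cc_one]

theorem one_leB {n : ℕ} {σ : Equiv.Perm ℤ} (hσ : inB n σ) : leB n 1 σ := by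
  rw [leB_iff (inB_one n) hσ]; simp [cc_one]

theorem leB_antisymm {n : ℕ} {τ σ : Equiv.Perm ℤ} (hτ : inB n τ) (hσ : inB n σ)
    (h1 : leB n τ σ) (h2 : leB n σ τ) : τ = σ := by
  rw [leB_iff hτ hσ] at h1
  rw [leB_iff hσ hτ] at h2
  have := cc_eq_zero (hτ.inv.mul hσ) (by omega)
  rw [inv_mul_eq_one] at this
  exact this

theorem finite_inB (n : ℕ) : {σ | inB n σ}.Finite := by
  have hinj : Function.Injective (fun (σ : {σ // inB n σ}) (x : Set.Icc (-(n:ℤ)) n) =>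
      (⟨σ.1 x, by
        by_cases hx : (x:ℤ) ∈ signedSet n
        · have := mem_ss.1 (σ.2.maps.2 hx); exact ⟨this.2.1, this.2.2⟩
        · rw [σ.2.2 _ hx]; exact x.2⟩ : Set.Icc (-(n:ℤ)) n)) := by
    rintro ⟨σ, hσ⟩ ⟨τ, hτ⟩ he
    simp only [Subtype.mk.injEq]
    ext x
    by_cases hx : x ∈ signedSet n
    · have hx' := mem_ss.1 hx
      have := congrFun he ⟨x, hx'.2.1, hx'.2.2⟩
      simpa using this
    · rw [hσ.2 x hx, hτ.2 x hx]
  have := Finite.of_injective _ hinj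
  exact Set.finite_coe_iff.1 this

end Order


section Teles
open Equiv.Perm

noncomputable def Bfin (n : ℕ) : Finset (Equiv.Perm ℤ) := (finite_inB n).toFinset

theorem mem_Bfin {n : ℕ} {σ : Equiv.Perm ℤ} : σ ∈ Bfin n ↔ inB n σ := by
  simp [Bfin]

theorem cc_bref_mul {n m : ℕ} (hmn : m + 1 ≤ n) {x : ℤ} (hx : x ∈ signedSet (m + 1))
    {u : Equiv.Perm ℤ} (hu : inB m u) :
    cc n (bref ((m:ℤ) + 1) x * u) = cc n (bref ((m:ℤ) + 1) x) + cc n u := by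
  have hm1 : ((m:ℤ) + 1) ∈ signedSet n := by rw [mem_ss]; omega
  have hx1 : x ∈ signedSet n := by rw [mem_ss] at *; push_cast at *; omega
  have hun : inB n u := hu.mono (by omega)
  by_cases hxm : ((m:ℤ) + 1) = x
  · rw [← hxm, bref_self (by omega)]; simp [cc_one]
  have hr := bref_root hm1 hx1 hxm
  have hB := bref_inB hm1 hx1
  unfold cc
  rw [act_mul hB hun]
  apply crk_mul_of_disjoint (act_liso hB) (act_liso hun)
  rw [hr.mov, eq_bot_iff]
  rintro w ⟨hw, hw'⟩
  obtain ⟨t, rfl⟩ := Submodule.mem_span_singleton.1 hw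
  have hfix : act n u (ee n ((m:ℤ) + 1)) = ee n ((m:ℤ) + 1) := by
    rw [act_ee hun, hu.2 _ (by rw [mem_ss]; omega)]
  rw [fix_iff (act_liso hun), Submodule.mem_orthogonal] at hfix
  have := hfix _ hw'
  rw [real_inner_comm, inner_ee, ev_smul, ev_sub, ev_ee _ hm1, ev_ee _ hm1, if_pos rfl,
    if_neg (show ((m:ℤ)+1) ≠ -((m:ℤ)+1) by omega), if_neg hxm] at this
  rw [Submodule.mem_bot]
  split_ifs at this
  · have : t = 0 := by linarith
    rw [this, zero_smul]
  · have : t = 0 := by linarith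
    rw [this, zero_smul]

theorem leB_inBm {n m : ℕ} {τ σ : Equiv.Perm ℤ} (hmn : m ≤ n) (hτ : inB n τ) (hσ : inB m σ)
    (hl : leB n τ σ) : inB m τ := by
  refine ⟨hτ.1, ?_⟩
  intro x hx
  by_cases hxn : x ∈ signedSet n
  · have h1 := leB_mov hτ (hσ.mono hmn) hl
    rw [Mov_le_iff (act_liso hτ) (act_liso (hσ.mono hmn))] at h1
    have h2 := h1 (ee n x) (by rw [act_ee (hσ.mono hmn), hσ.2 x hx])
    rw [act_ee hτ] at h2
    exact ee_inj (hτ.maps.2 hxn) h2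
  · exact hτ.2 x hxn

open Classical in
theorem teles {n : ℕ} {γ : Equiv.Perm ℤ} (hγ : inB n γ) (f : Equiv.Perm ℤ → ℚ)
    (H : ∀ σ, inB n σ → leB n σ γ → σ ≠ 1 → ∑ τ ∈ (Bfin n).filter (fun τ => leB n τ σ), f τ = 0)
    (m : ℕ) (hmn : m + 1 ≤ n) :
    ∀ k, ∀ σ, cc n σ = k → inB (m + 1) σ → σ ((m:ℤ) + 1) ≠ (m:ℤ) + 1 → leB n σ γ →
    ∑ x ∈ (Finset.Icc (-((m:ℤ) + 1)) ((m:ℤ) + 1)).filter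
      (fun x => x ≠ 0 ∧ RR σ ((m:ℤ) + 1) x), f (σ * bref ((m:ℤ) + 1) x) = 0 := by
  intro k
  induction k using Nat.strong_induction_on with
  | _ k ih =>
  intro σ hk hσ hσm hle
  set M : ℤ := (m:ℤ) + 1 with hM
  have hM0 : M ≠ 0 := by omega
  have hMn : M ∈ signedSet n := by rw [mem_ss]; omega
  have hMm : M ∈ signedSet (m+1) := by rw [mem_ss]; push_cast; omega
  have hσn : inB n σ := hσ.mono hmn
  set X : Finset ℤ := (Finset.Icc (-M) M).erase 0 with hX
  have memX : ∀ x, x ∈ X ↔ x ∈ signedSet (m+1) := by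
    intro x; rw [hX, Finset.mem_erase, Finset.mem_Icc, mem_ss]; push_cast; rfl
  have ssn : ∀ x, x ∈ signedSet (m+1) → x ∈ signedSet n := by
    intro x hx; rw [mem_ss] at *; push_cast at *; omega
  -- condition
  have hcond : ∀ s, inB n s → ∀ x ∈ signedSet (m+1),
      (RR s M x ↔ cc n s = cc n (s * bref M x) + cc n (bref M x)) := by
    intro s hs x hx
    by_cases hMx : M = x
    · rw [← hMx, bref_self hM0]
      simp only [mul_one, cc_one, add_zero, iff_true]
      exact Or.inl (SameCycle.refl s M)
    · rw [RR_iff hs hMn (ssn x hx), ← cc_bref_down hs hMn (ssn x hx) hMx,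
        cc_bref hMn (ssn x hx) hMx]
      exact eq_comm
  have hfilt : ∀ s, (Finset.Icc (-M) M).filter (fun x => x ≠ 0 ∧ RR s M x) =
      X.filter (fun x => RR s M x) := by
    intro s; ext x; simp only [hX, Finset.mem_filter, Finset.mem_erase]; tauto
  let D : Finset (Equiv.Perm ℤ) :=
    (Bfin m).filter (fun u => cc n σ = cc n (σ * u⁻¹) + cc n u)
  have hsum : ∑ τ ∈ (Bfin n).filter (fun τ => leB n τ σ), f τ =
      ∑ u ∈ D, ∑ x ∈ X.filter (fun x => RR (σ * u⁻¹) M x), f (σ * u⁻¹ * bref M x) := by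
    rw [Finset.sum_sigma']
    refine Finset.sum_bij' (fun τ _ => ⟨bref M ((τ⁻¹ * σ) M) * (τ⁻¹ * σ), (τ⁻¹ * σ) M⟩)
      (fun p _ => σ * p.1⁻¹ * bref M p.2) ?_ ?_ ?_ ?_ ?_
    · intro τ hτ
      rw [Finset.mem_filter, mem_Bfin] at hτ
      obtain ⟨hτ, hl⟩ := hτ
      have hτm := leB_inBm hmn hτ hσ hl
      have hu := hτm.inv.mul hσ
      set u := τ⁻¹ * σ with hudef
      have hx : u M ∈ signedSet (m+1) := hu.maps.2 hMm
      have hx0 := (mem_ss.1 hx).1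
      set x := u M with hxdef
      have hrB := bref_inB hMm hx
      have hu' : inB m (bref M x * u) := by
        refine ⟨(hrB.mul hu).1, ?_⟩
        intro y hy
        by_cases hym : y ∈ signedSet (m+1)
        · have hfx : (bref M x * u) M = M := by
            rw [Equiv.Perm.mul_apply, ← hxdef, bref_apply hM0 hx0]
            split_ifs <;> omega
          have hy2 : y = M ∨ y = -M := by
            rw [mem_ss] at hy hym; push_cast at hym; omega
          rcases hy2 with rfl | rfl
          · exact hfx
          · rw [(hrB.mul hu).1, hfx]
        · exact (hrB.mul hu).2 y hym
      have hrn := bref_inB hMn (ssn x hx)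
      have hun : inB n u := hu.mono hmn
      have hu'n : inB n (bref M x * u) := hu'.mono (by omega)
      have e0 : bref M x * (bref M x * u) = u := by
        rw [← mul_assoc, bref_mul_self hM0 hx0, one_mul]
      have e1 := cc_bref_mul hmn hx hu'
      rw [← hM, e0] at e1
      have e2 : σ * (bref M x * u)⁻¹ * bref M x = τ := by
        rw [mul_inv_rev, bref_inv hM0 hx0, mul_assoc, mul_assoc, bref_mul_self hM0 hx0, mul_one,
          hudef, mul_inv_rev, inv_inv]
        simp
      have e3 : σ * (bref M x * u)⁻¹ = τ * bref M x := by
        rw [← e2, mul_assoc (σ * _), bref_mul_self hM0 hx0, mul_one]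
      rw [leB_iff hτ hσn, ← hudef] at hl
      have b1 := cc_mul_le hτ hrn
      have b2 := cc_mul_le (hτ.mul hrn) hu'n
      rw [mul_assoc τ, e0, hudef, show τ * (τ⁻¹ * σ) = σ by group, ← hudef] at b2
      rw [Finset.mem_sigma, Finset.mem_filter, Finset.mem_filter, mem_Bfin, memX]
      refine ⟨⟨hu', ?_⟩, hx, ?_⟩
      · show cc n σ = cc n (σ * (bref M x * u)⁻¹) + cc n (bref M x * u)
        rw [e3]; omega
      · show RR (σ * (bref M x * u)⁻¹) M x
        rw [hcond _ (hσn.mul hu'n.inv) x hx, e2, e3]; omega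
    · rintro ⟨u, x⟩ hp
      rw [Finset.mem_sigma, Finset.mem_filter, Finset.mem_filter, mem_Bfin, memX] at hp
      obtain ⟨⟨hu, h1⟩, hx, h2⟩ := hp
      simp only at *
      have hx0 := (mem_ss.1 hx).1
      have hun : inB n u := hu.mono (by omega)
      have hrn := bref_inB hMn (ssn x hx)
      rw [hcond _ (hσn.mul hun.inv) x hx] at h2
      have hτ := (hσn.mul hun.inv).mul hrn
      rw [Finset.mem_filter, mem_Bfin]
      refine ⟨hτ, ?_⟩
      rw [leB_iff hτ hσn]
      have e : (σ * u⁻¹ * bref M x)⁻¹ * σ = bref M x * u := by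
        rw [mul_inv_rev, bref_inv hM0 hx0]; group
      rw [e, cc_bref_mul hmn hx hu, ← hM]
      omega
    · intro τ hτ
      rw [Finset.mem_filter, mem_Bfin] at hτ
      obtain ⟨hτ, hl⟩ := hτ
      have hu := (hτ.inv.mul hσn)
      have hx0 := (mem_ss.1 (hu.maps.2 hMn)).1
      simp only
      rw [mul_inv_rev, bref_inv hM0 hx0, mul_assoc, mul_assoc, bref_mul_self hM0 hx0, mul_one]
      group
    · rintro ⟨u, x⟩ hp
      rw [Finset.mem_sigma, Finset.mem_filter, Finset.mem_filter, mem_Bfin, memX] at hp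
      obtain ⟨⟨hu, h1⟩, hx, h2⟩ := hp
      simp only at *
      have hx0 := (mem_ss.1 hx).1
      have e : (σ * u⁻¹ * bref M x)⁻¹ * σ = bref M x * u := by
        rw [mul_inv_rev, bref_inv hM0 hx0]; group
      have huM : u M = M := hu.2 _ (by rw [mem_ss]; omega)
      have hxx : (bref M x * u) M = x := by
        rw [Equiv.Perm.mul_apply, huM, bref_apply hM0 hx0, if_pos rfl]
      rw [e, hxx, ← mul_assoc, bref_mul_self hM0 hx0, one_mul]
    · intro τ hτ
      rw [Finset.mem_filter, mem_Bfin] at hτ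
      obtain ⟨hτ, hl⟩ := hτ
      have hu := (hτ.inv.mul hσn)
      have hx0 := (mem_ss.1 (hu.maps.2 hMn)).1
      simp only
      rw [mul_inv_rev, bref_inv hM0 hx0, mul_assoc, mul_assoc, bref_mul_self hM0 hx0, mul_one]
      congr 1
      group
  have hσ1 : σ ≠ 1 := by rintro rfl; exact hσm rfl
  rw [H σ hσn hle hσ1] at hsum
  have h1D : (1 : Equiv.Perm ℤ) ∈ D := by
    simp only [D, Finset.mem_filter, mem_Bfin]
    exact ⟨inB_one m, by simp [cc_one]⟩
  rw [Finset.sum_eq_single_of_mem 1 h1D] at hsum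
  · rw [hfilt]
    simpa using hsum.symm
  · intro u hu hu1
    simp only [D, Finset.mem_filter, mem_Bfin] at hu
    obtain ⟨hu, huc⟩ := hu
    have hun : inB n u := hu.mono (by omega)
    have hpos : cc n u ≠ 0 := fun h0 => hu1 (cc_eq_zero hun h0)
    have hsn := hσn.mul hun.inv
    have := ih (cc n (σ * u⁻¹)) (by omega) (σ * u⁻¹) rfl (hσ.mul (hu.inv.mono (by omega))) (by
      rw [Equiv.Perm.mul_apply, hu.inv.2 M (by rw [mem_ss]; omega)]; exact hσm)
      (leB_trans hsn hσn hγ (by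
        rw [leB_iff hsn hσn, huc]
        congr 2
        group) hle)
    rw [hfilt] at this
    exact this

end Teles

section Fsec
open Equiv Equiv.Perm

/-- `a → l → b` is a walk along `σ`. -/
def Wk (σ : Equiv.Perm ℤ) : ℤ → List ℤ → ℤ → Prop
  | a, [], b => σ a = b
  | a, x :: l, b => σ a = x ∧ Wk σ x l b

theorem Wk_append {σ : Equiv.Perm ℤ} (l1 : List ℤ) (x : ℤ) (l2 : List ℤ) (b : ℤ) :
    ∀ a, Wk σ a (l1 ++ x :: l2) b ↔ Wk σ a l1 x ∧ Wk σ x l2 b := by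
  induction l1 with
  | nil => intro a; simp [Wk]
  | cons y l ih => intro a; simp [Wk, ih, and_assoc]

theorem Wk_neg {σ : Equiv.Perm ℤ} (h : ∀ x, σ (-x) = - σ x) (l : List ℤ) (b : ℤ) :
    ∀ a, Wk σ a l b → Wk σ (-a) (l.map (fun z => -z)) (-b) := by
  induction l with
  | nil => intro a; simp [Wk, h]
  | cons y l ih =>
    intro a; simp only [Wk, List.map_cons, h]; rintro ⟨rfl, h2⟩; exact ⟨rfl, ih _ h2⟩

theorem Wk_head {σ σ' : Equiv.Perm ℤ} (l : List ℤ) (b : ℤ) :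
    ∀ a a', σ' a' = σ a → (∀ z ∈ l, σ' z = σ z) → Wk σ a l b → Wk σ' a' l b := by
  induction l with
  | nil => intro a a' h _; simp [Wk, h]
  | cons y l ih =>
    intro a a' h h2; simp only [Wk, h]; rintro ⟨rfl, h3⟩
    exact ⟨rfl, ih _ _ (h2 _ (by simp)) (fun z hz => h2 z (by simp [hz])) h3⟩

theorem Wk_fwd {σ : Equiv.Perm ℤ} (l : List ℤ) (b : ℤ) :
    ∀ a, Wk σ a l b → (∀ z ∈ a :: l, σ z ∈ l ++ [b]) ∧ (∀ z ∈ l ++ [b], ∃ w ∈ a :: l, σ w = z) ∧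
      (∀ z ∈ l ++ [b], SameCycle σ a z) := by
  induction l with
  | nil => intro a h; simp only [Wk] at h; subst h; simp [SameCycle.refl]
  | cons y l ih =>
    rintro a ⟨rfl, h⟩
    obtain ⟨h1, h2, h3⟩ := ih _ h
    have h0 : SameCycle σ a (σ a) := by simp [SameCycle.refl]
    refine ⟨?_, ?_, ?_⟩
    · intro z hz
      rcases List.mem_cons.1 hz with rfl | hz
      · simp
      · have := h1 z hz
        rw [List.cons_append]; exact List.mem_cons_of_mem _ this
    · intro z hz
      rw [List.cons_append] at hz
      rcases List.mem_cons.1 hz with rfl | hz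
      · exact ⟨a, by simp, rfl⟩
      · obtain ⟨w, hw, e⟩ := h2 z hz
        exact ⟨w, List.mem_cons_of_mem _ hw, e⟩
    · intro z hz
      rw [List.cons_append] at hz
      rcases List.mem_cons.1 hz with rfl | hz
      · exact h0
      · exact h0.trans (h3 z hz)

theorem Wk_same {σ : Equiv.Perm ℤ} {a : ℤ} {l : List ℤ} (h : Wk σ a l a) {x y : ℤ}
    (hx : x ∈ a :: l) : SameCycle σ x y ↔ y ∈ a :: l := by
  obtain ⟨h1, h2, h3⟩ := Wk_fwd l a a h
  have e : ∀ z, z ∈ l ++ [a] ↔ z ∈ a :: l := by intro z; simp [or_comm]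
  have hf : ∀ z ∈ a :: l, σ z ∈ a :: l := fun z hz => (e _).1 (h1 z hz)
  have hb : ∀ z ∈ a :: l, σ⁻¹ z ∈ a :: l := by
    intro z hz
    obtain ⟨w, hw, rfl⟩ := h2 z ((e _).2 hz)
    simpa using hw
  constructor
  · rintro ⟨i, rfl⟩
    induction i using Int.induction_on with
    | zero => simpa using hx
    | succ i ih => rw [add_comm, zpow_add, mul_apply, zpow_one]; exact hf _ ih
    | pred i ih => rw [sub_eq_add_neg, add_comm, zpow_add, mul_apply, zpow_neg_one]; exact hb _ ih
  · intro hy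
    exact (h3 x ((e _).2 hx)).symm.trans (h3 y ((e _).2 hy))

/-- The list `l` is a cycle of `σ` (positive if `ε = 1`, negative if `ε = -1`). -/
def Cyc (σ : Equiv.Perm ℤ) (ε : ℤ) : List ℤ → Prop
  | [] => False
  | a :: t => Wk σ a t (ε * a)

theorem Cyc_congr {σ σ' : Equiv.Perm ℤ} {ε : ℤ} {l : List ℤ} (h : ∀ z ∈ l, σ' z = σ z)
    (hc : Cyc σ ε l) : Cyc σ' ε l := by
  cases l with
  | nil => exact hc
  | cons a t => exact Wk_head _ _ _ _ (h a (by simp)) (fun z hz => h z (by simp [hz])) hc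

theorem Cyc_neg {σ : Equiv.Perm ℤ} (ho : ∀ x, σ (-x) = - σ x) {ε : ℤ} {l : List ℤ}
    (hc : Cyc σ ε l) : Cyc σ ε (l.map (fun z => -z)) := by
  cases l with
  | nil => exact hc
  | cons a t =>
    have := Wk_neg ho _ _ _ hc
    simpa [Cyc] using this

theorem Cyc_rot_aux {σ : Equiv.Perm ℤ} (ho : ∀ x, σ (-x) = - σ x) {ε : ℤ} (hε : ε = 1 ∨ ε = -1)
    {l : List ℤ} (hc : Cyc σ ε l) {x : ℤ} (hx : x ∈ l) :
    ∃ t, Cyc σ ε (x :: t) ∧ ((x :: t).map Int.natAbs).Perm (l.map Int.natAbs) := by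
  cases l with
  | nil => simp at hx
  | cons a t =>
    rcases List.mem_cons.1 hx with rfl | hx
    · exact ⟨t, hc, List.Perm.refl _⟩
    obtain ⟨t1, t2, rfl⟩ := List.append_of_mem hx
    have hc' := (Wk_append _ _ _ _ _).1 hc
    rcases hε with rfl | rfl
    · refine ⟨t2 ++ a :: t1, ?_, ?_⟩
      · rw [Cyc, Wk_append]
        simpa using hc'.symm
      · apply List.Perm.map
        rw [List.perm_iff_count]; intro z; simp [List.count_cons, List.count_append]; omega
    · refine ⟨t2 ++ (-a) :: t1.map (fun z => -z), ?_, ?_⟩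
      · rw [Cyc, Wk_append]
        refine ⟨by simpa using hc'.2, ?_⟩
        simpa using Wk_neg ho _ _ _ hc'.1
      · rw [List.perm_iff_count]; intro z
        have e : Int.natAbs ∘ (fun z : ℤ => -z) = Int.natAbs := by funext z; simp
        simp [List.count_cons, List.count_append, e]; omega

theorem natAbs_map_neg (l : List ℤ) :
    (l.map (fun z => -z)).map Int.natAbs = l.map Int.natAbs := by
  rw [List.map_map]; congr 1; funext z; simp

theorem Cyc_rot {σ : Equiv.Perm ℤ} (ho : ∀ x, σ (-x) = - σ x) {ε : ℤ} (hε : ε = 1 ∨ ε = -1)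
    {l : List ℤ} (hc : Cyc σ ε l) {x : ℤ} (hx : x.natAbs ∈ l.map Int.natAbs) :
    ∃ t, Cyc σ ε (x :: t) ∧ ((x :: t).map Int.natAbs).Perm (l.map Int.natAbs) := by
  obtain ⟨y, hy, e⟩ := List.mem_map.1 hx
  rcases Int.natAbs_eq_natAbs_iff.1 e with rfl | rfl
  · exact Cyc_rot_aux ho hε hc hy
  · obtain ⟨t, h1, h2⟩ := Cyc_rot_aux ho hε hc hy
    refine ⟨t.map (fun z => -z), by simpa using Cyc_neg ho h1, ?_⟩
    rw [← natAbs_map_neg] at h2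
    simpa using h2

theorem Cyc_same_pos {σ : Equiv.Perm ℤ} {l : List ℤ} (hc : Cyc σ 1 l) {x y : ℤ} (hx : x ∈ l) :
    SameCycle σ x y ↔ y ∈ l := by
  cases l with
  | nil => simp at hx
  | cons a t => exact Wk_same (by simpa [Cyc] using hc) hx

theorem Cyc_same_neg {σ : Equiv.Perm ℤ} (ho : ∀ x, σ (-x) = - σ x) {l : List ℤ}
    (hc : Cyc σ (-1) l) {x y : ℤ} (hx : x ∈ l) :
    SameCycle σ x y ↔ y ∈ l ++ l.map (fun z => -z) := by
  cases l with
  | nil => simp at hx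
  | cons a t =>
    have h1 : Wk σ a t (-a) := by simpa [Cyc] using hc
    have h2 := Wk_neg ho _ _ _ h1
    rw [neg_neg] at h2
    have h3 := (Wk_append t (-a) _ _ _).2 ⟨h1, h2⟩
    have := Wk_same (x := x) (y := y) h3 (by simp at hx ⊢; tauto)
    rw [this]
    simp

end Fsec

section Hsec
open Equiv Equiv.Perm

/-- Cycle data for `σ`. -/
structure Valid (n : ℕ) (σ : Equiv.Perm ℤ) (L K : List (List ℤ)) : Prop where
  pos : ∀ l ∈ L, Cyc σ 1 l
  neg : ∀ l ∈ K, Cyc σ (-1) l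
  cov : ((L ++ K).flatten.map Int.natAbs).Perm (List.range' 1 n)

theorem Valid.nodup {n : ℕ} {σ : Equiv.Perm ℤ} {L K : List (List ℤ)} (h : Valid n σ L K) :
    ((L ++ K).flatten.map Int.natAbs).Nodup := h.cov.nodup_iff.2 List.nodup_range'

theorem Valid.ne0 {n : ℕ} {σ : Equiv.Perm ℤ} {L K : List (List ℤ)} (h : Valid n σ L K) {x : ℤ}
    (hx : x.natAbs ∈ (L ++ K).flatten.map Int.natAbs) : x ≠ 0 := by
  rw [h.cov.mem_iff, List.mem_range'_1] at hx
  omega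

theorem flat_count (L K : List (List ℤ)) (z : ℕ) :
    List.count z ((L ++ K).flatten.map Int.natAbs) =
      List.count z (L.flatten.map Int.natAbs) + List.count z (K.flatten.map Int.natAbs) := by
  simp

theorem Valid.upd {n : ℕ} {σ σ' : Equiv.Perm ℤ} {L0 L' K0 K' L1 K1 L K : List (List ℤ)}
    (h : Valid n σ L K) (hL : L.Perm (L0 ++ L')) (hK : K.Perm (K0 ++ K'))
    (hagree : ∀ z, z.natAbs ∉ ((L0 ++ K0).flatten.map Int.natAbs) → σ' z = σ z)
    (h1 : ∀ l ∈ L1, Cyc σ' 1 l) (h2 : ∀ l ∈ K1, Cyc σ' (-1) l)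
    (h3 : ((L1 ++ K1).flatten.map Int.natAbs).Perm ((L0 ++ K0).flatten.map Int.natAbs)) :
    Valid n σ' (L1 ++ L') (K1 ++ K') := by
  have hp : ((L ++ K).flatten.map Int.natAbs).Perm
      (((L0 ++ K0).flatten.map Int.natAbs) ++ ((L' ++ K').flatten.map Int.natAbs)) := by
    have a1 := (hL.flatten).map Int.natAbs
    have a2 := (hK.flatten).map Int.natAbs
    rw [List.perm_iff_count] at a1 a2 ⊢
    intro z
    have := a1 z; have := a2 z
    simp only [List.flatten_append, List.map_append, List.count_append] at *
    omega
  have hnd := hp.nodup_iff.1 h.nodup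
  have hdis := List.disjoint_of_nodup_append hnd
  have key : ∀ l ∈ L' ++ K', ∀ z ∈ l, σ' z = σ z := by
    intro l hl z hz
    apply hagree
    intro hz'
    exact hdis hz' (List.mem_map_of_mem (List.mem_flatten_of_mem hl hz))
  refine ⟨?_, ?_, ?_⟩
  · intro l hl
    rcases List.mem_append.1 hl with hl | hl
    · exact h1 l hl
    · exact Cyc_congr (key l (by simp [hl])) (h.pos l (hL.mem_iff.2 (by simp [hl])))
  · intro l hl
    rcases List.mem_append.1 hl with hl | hl
    · exact h2 l hl
    · exact Cyc_congr (key l (by simp [hl])) (h.neg l (hK.mem_iff.2 (by simp [hl])))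
  · refine List.Perm.trans ?_ h.cov
    refine List.Perm.trans ?_ hp.symm
    rw [List.perm_iff_count] at h3 ⊢
    intro z
    have := h3 z
    simp only [List.flatten_append, List.map_append, List.count_append] at *
    omega

theorem Valid.mem_iff {n : ℕ} {σ : Equiv.Perm ℤ} {L K : List (List ℤ)} (h : Valid n σ L K) {x : ℤ} :
    x.natAbs ∈ (L ++ K).flatten.map Int.natAbs ↔ x ∈ signedSet n := by
  rw [h.cov.mem_iff, List.mem_range'_1, mem_ss]; omega

theorem mem_flat {L : List (List ℤ)} {x : ℕ} (h : x ∈ L.flatten.map Int.natAbs) :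
    ∃ l ∈ L, x ∈ l.map Int.natAbs := by
  obtain ⟨y, hy, e⟩ := List.mem_map.1 h
  obtain ⟨l, hl, hy⟩ := List.mem_flatten.1 hy
  exact ⟨l, hl, List.mem_map.2 ⟨y, hy, e⟩⟩

theorem Valid.normL {n : ℕ} {σ : Equiv.Perm ℤ} (ho : inB n σ) {L K : List (List ℤ)}
    (h : Valid n σ L K) {M : ℤ} (hM : M.natAbs ∈ L.flatten.map Int.natAbs) :
    ∃ t L', Valid n σ ((M :: t) :: L') K ∧
      (L.map List.length).Perm ((t.length + 1) :: L'.map List.length) := by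
  obtain ⟨l, hl, hMl⟩ := mem_flat hM
  obtain ⟨t, h1, h2⟩ := Cyc_rot ho.1 (Or.inl rfl) (h.pos l hl) hMl
  have hp := List.perm_cons_erase hl
  refine ⟨t, L.erase l, ?_, ?_⟩
  · have := h.upd (σ' := σ) (L0 := [l]) (L' := L.erase l) (K0 := []) (K' := K) (L1 := [M :: t])
      (K1 := []) (by simpa using hp) (by simp) (by simp) (by simpa using h1) (by simp)
      (by simpa using h2)
    simpa using this
  · have e := h2.length_eq
    simp only [List.length_map, List.length_cons] at e
    rw [e]
    simpa using hp.map List.length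

theorem Valid.normK {n : ℕ} {σ : Equiv.Perm ℤ} (ho : inB n σ) {L K : List (List ℤ)}
    (h : Valid n σ L K) {M : ℤ} (hM : M.natAbs ∈ K.flatten.map Int.natAbs) :
    ∃ t K', Valid n σ L ((M :: t) :: K') ∧
      (K.map List.length).Perm ((t.length + 1) :: K'.map List.length) := by
  obtain ⟨l, hl, hMl⟩ := mem_flat hM
  obtain ⟨t, h1, h2⟩ := Cyc_rot ho.1 (Or.inr rfl) (h.neg l hl) hMl
  have hp := List.perm_cons_erase hl
  refine ⟨t, K.erase l, ?_, ?_⟩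
  · have := h.upd (σ' := σ) (L0 := []) (L' := L) (K0 := [l]) (K' := K.erase l) (L1 := [])
      (K1 := [M :: t]) (by simp) (by simpa using hp) (by simp) (by simp) (by simpa using h1)
      (by simpa using h2)
    simpa using this
  · have e := h2.length_eq
    simp only [List.length_map, List.length_cons] at e
    rw [e]
    simpa using hp.map List.length

theorem Valid.RR_pos {n : ℕ} {σ : Equiv.Perm ℤ} {L K : List (List ℤ)} {M : ℤ} {t : List ℤ}
    (h : Valid n σ ((M :: t) :: L) K) : ¬ SameCycle σ M (-M) ∧ ∀ x, RR σ M x ↔ x ∈ M :: t := by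
  have hM0 : M ≠ 0 := h.ne0 (by simp)
  have hns : ¬ SameCycle σ M (-M) := by
    rw [Cyc_same_pos (h.pos (M :: t) (by simp)) (by simp)]
    intro hm
    rcases List.mem_cons.1 hm with hm | hm
    · omega
    · have := h.nodup
      simp only [List.cons_append, List.flatten_cons, List.map_cons, List.nodup_cons] at this
      apply this.1
      simp only [List.map_append, List.mem_append]
      left
      rw [← Int.natAbs_neg]
      exact List.mem_map_of_mem hm
  refine ⟨hns, fun x => ?_⟩
  unfold RR
  rw [Cyc_same_pos (h.pos (M :: t) (by simp)) (by simp)]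
  tauto

theorem Valid.RR_neg {n : ℕ} {σ : Equiv.Perm ℤ} (ho : inB n σ) {L K : List (List ℤ)} {M : ℤ}
    {t : List ℤ} (h : Valid n σ L ((M :: t) :: K)) {x : ℤ} (hx : x ≠ 0) :
    RR σ M x ↔ x.natAbs ∈ ((M :: t) :: K).flatten.map Int.natAbs := by
  have hM : M ∈ signedSet n := h.mem_iff.1 (by simp)
  have hs : SameCycle σ M (-M) := by
    rw [Cyc_same_neg ho.1 (h.neg (M :: t) (by simp)) (by simp)]; simp
  have e : RR σ M x ↔ SameCycle σ x (-x) := by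
    constructor
    · rintro (h1 | h1)
      · exact h1.symm.trans (hs.trans ((sc_neg ho).2 h1))
      · exact h1.2
    · intro h1; exact Or.inr ⟨hs, h1⟩
  constructor
  · intro hr
    have hxs := RR_mem ho hM hr hx
    have := h.mem_iff.2 hxs
    rw [List.flatten_append, List.map_append, List.mem_append] at this
    rcases this with hL | hK
    · exfalso
      obtain ⟨t', L', hv, _⟩ := h.normL ho hL
      exact hv.RR_pos.1 (e.1 hr)
    · exact hK
  · intro hK
    rw [e]
    obtain ⟨l, hl, hMl⟩ := mem_flat hK
    obtain ⟨t', h1, h2⟩ := Cyc_rot ho.1 (Or.inr rfl) (h.neg l hl) hMl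
    rw [Cyc_same_neg ho.1 h1 (by simp)]; simp

theorem bref_mul_apply {σ : Equiv.Perm ℤ} {M x : ℤ} (hM : M ≠ 0) (hx : x ≠ 0) :
    (σ * bref M x) M = σ x ∧ (σ * bref M x) x = σ M ∧
      ∀ z, z.natAbs ≠ M.natAbs → z.natAbs ≠ x.natAbs → (σ * bref M x) z = σ z := by
  refine ⟨?_, ?_, ?_⟩
  · rw [mul_apply, bref_apply hM hx]; simp
  · rw [mul_apply, bref_apply hM hx]; simp only [if_true]; split_ifs with h
    · rw [h]
    · rfl
  · intro z h1 h2
    rw [mul_apply, bref_apply hM hx]; split_ifs <;> first | rfl | omega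

theorem Valid.step_pos {n : ℕ} {σ : Equiv.Perm ℤ} {L K : List (List ℤ)} {M x : ℤ}
    {t1 t2 : List ℤ} (h : Valid n σ ((M :: (t1 ++ x :: t2)) :: L) K) :
    Valid n (σ * bref M x) ((M :: t2) :: (x :: t1) :: L) K := by
  have hM0 : M ≠ 0 := h.ne0 (by simp)
  have hx0 : x ≠ 0 := h.ne0 (by simp)
  obtain ⟨b1, b2, b3⟩ := bref_mul_apply (σ := σ) hM0 hx0
  have hnd := h.nodup
  have hc := h.pos _ (List.mem_cons_self)
  simp only [Cyc, one_mul] at hc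
  rw [Wk_append] at hc
  simp only [List.cons_append, List.flatten_cons, List.map_cons, List.map_append, List.append_assoc,
    List.nodup_cons, List.nodup_append, List.mem_append, List.mem_cons, not_or] at hnd
  have a1 : ∀ z ∈ t2, (σ * bref M x) z = σ z := by
    intro z hz
    have hz := List.mem_map_of_mem (f := Int.natAbs) hz
    apply b3 <;> intro e <;> rw [e] at hz
    · exact hnd.1.2.2.1 hz
    · exact hnd.2.2.1.1.1 hz
  have a2 : ∀ z ∈ t1, (σ * bref M x) z = σ z := by
    intro z hz
    have hz := List.mem_map_of_mem (f := Int.natAbs) hz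
    apply b3
    · intro e; rw [e] at hz; exact hnd.1.1 hz
    · exact hnd.2.2.2 _ hz _ (Or.inl rfl)
  have := h.upd (σ' := σ * bref M x) (L0 := [M :: (t1 ++ x :: t2)]) (L' := L) (K0 := []) (K' := K)
    (L1 := [M :: t2, x :: t1]) (K1 := []) (by simp) (by simp)
    (by intro z hz; simp at hz; apply b3 <;> tauto)
    (by
      intro l hl
      simp only [List.mem_cons, List.not_mem_nil, or_false] at hl
      rcases hl with rfl | rfl
      · simp only [Cyc, one_mul]; exact Wk_head _ _ _ _ b1 a1 hc.2
      · simp only [Cyc, one_mul]; exact Wk_head _ _ _ _ b2 a2 hc.1) (by simp)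
    (by rw [List.perm_iff_count]; intro z
        simp [List.count_cons]; omega)
  simpa using this

end Hsec

section Jsec
open Equiv Equiv.Perm

theorem Valid.nodup_of_mem {n : ℕ} {σ : Equiv.Perm ℤ} {L K : List (List ℤ)} (h : Valid n σ L K)
    {l : List ℤ} (hl : l ∈ L ++ K) : (l.map Int.natAbs).Nodup :=
  h.nodup.sublist ((List.sublist_flatten_of_mem hl).map _)

theorem nd_split {M x : ℤ} {t1 t2 : List ℤ}
    (hnd : ((M :: (t1 ++ x :: t2)).map Int.natAbs).Nodup) :
    (∀ z ∈ t1, z.natAbs ≠ M.natAbs ∧ z.natAbs ≠ x.natAbs) ∧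
    (∀ z ∈ t2, z.natAbs ≠ M.natAbs ∧ z.natAbs ≠ x.natAbs) := by
  simp only [List.map_cons, List.map_append,
    List.nodup_cons, List.nodup_append, List.mem_append, List.mem_cons, not_or] at hnd
  constructor
  · intro z hz
    have hz := List.mem_map_of_mem (f := Int.natAbs) hz
    constructor
    · intro e; rw [e] at hz; exact hnd.1.1 hz
    · exact hnd.2.2.2 _ hz _ (Or.inl rfl)
  · intro z hz
    have hz := List.mem_map_of_mem (f := Int.natAbs) hz
    constructor <;> intro e <;> rw [e] at hz
    · exact hnd.1.2.2 hz
    · exact hnd.2.2.1.1 hz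

theorem Valid.step_neg1 {n : ℕ} {σ : Equiv.Perm ℤ} {L K : List (List ℤ)} {M x : ℤ}
    {t1 t2 : List ℤ} (h : Valid n σ L ((M :: (t1 ++ x :: t2)) :: K)) :
    Valid n (σ * bref M x) ((x :: t1) :: L) ((M :: t2) :: K) := by
  have hM0 : M ≠ 0 := h.ne0 (by simp)
  have hx0 : x ≠ 0 := h.ne0 (by simp)
  obtain ⟨b1, b2, b3⟩ := bref_mul_apply (σ := σ) hM0 hx0
  obtain ⟨n1, n2⟩ := nd_split (h.nodup_of_mem (l := M :: (t1 ++ x :: t2)) (by simp))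
  have hc := h.neg _ (List.mem_cons_self)
  simp only [Cyc] at hc
  rw [Wk_append] at hc
  have := h.upd (σ' := σ * bref M x) (K0 := [M :: (t1 ++ x :: t2)]) (L' := L) (L0 := []) (K' := K)
    (L1 := [x :: t1]) (K1 := [M :: t2]) (by simp) (by simp)
    (by intro z hz; simp at hz; apply b3 <;> tauto)
    (by
      intro l hl
      simp only [List.mem_singleton] at hl
      subst hl
      simp only [Cyc, one_mul]
      exact Wk_head _ _ _ _ b2 (fun z hz => b3 z (n1 z hz).1 (n1 z hz).2) hc.1)
    (by
      intro l hl
      simp only [List.mem_singleton] at hl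
      subst hl
      simp only [Cyc]
      exact Wk_head _ _ _ _ b1 (fun z hz => b3 z (n2 z hz).1 (n2 z hz).2) hc.2)
    (by rw [List.perm_iff_count]; intro z
        simp [List.count_cons]; omega)
  simpa using this

theorem natAbs_comp_neg : Int.natAbs ∘ (fun z : ℤ => -z) = Int.natAbs := by funext z; simp

theorem Valid.step_neg2 {n : ℕ} {σ : Equiv.Perm ℤ} (ho : inB n σ) {L K : List (List ℤ)} {M x : ℤ}
    {t1 t2 : List ℤ} (h : Valid n σ L ((M :: (t1 ++ x :: t2)) :: K)) :
    Valid n (σ * bref M (-x)) ((M :: t2.map (fun z => -z)) :: L) (((-x) :: t1) :: K) := by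
  have hM0 : M ≠ 0 := h.ne0 (by simp)
  have hx0 : x ≠ 0 := h.ne0 (by simp)
  obtain ⟨b1, b2, b3⟩ := bref_mul_apply (σ := σ) hM0 (neg_ne_zero.2 hx0)
  simp only [Int.natAbs_neg] at b3
  obtain ⟨n1, n2⟩ := nd_split (h.nodup_of_mem (l := M :: (t1 ++ x :: t2)) (by simp))
  have hc := h.neg _ (List.mem_cons_self)
  simp only [Cyc] at hc
  rw [Wk_append] at hc
  have := h.upd (σ' := σ * bref M (-x)) (K0 := [M :: (t1 ++ x :: t2)]) (L' := L) (L0 := []) (K' := K)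
    (L1 := [M :: t2.map (fun z => -z)]) (K1 := [(-x) :: t1]) (by simp) (by simp)
    (by intro z hz; simp at hz; apply b3 <;> tauto)
    (by
      intro l hl
      simp only [List.mem_singleton] at hl
      subst hl
      simp only [Cyc, one_mul]
      have := Wk_neg ho.1 _ _ _ hc.2
      simp only [neg_one_mul, neg_neg] at this
      refine Wk_head _ _ _ _ b1 (fun z hz => ?_) this
      obtain ⟨w, hw, rfl⟩ := List.mem_map.1 hz
      apply b3 <;> rw [Int.natAbs_neg]
      exacts [(n2 w hw).1, (n2 w hw).2])
    (by
      intro l hl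
      simp only [List.mem_singleton] at hl
      subst hl
      simp only [Cyc, neg_one_mul, neg_neg]
      exact Wk_head _ _ _ _ b2 (fun z hz => b3 z (n1 z hz).1 (n1 z hz).2) hc.1)
    (by rw [List.perm_iff_count]; intro z
        simp [List.count_cons, natAbs_comp_neg]; omega)
  simpa using this

theorem Valid.step_neg3 {n : ℕ} {σ : Equiv.Perm ℤ} (ho : inB n σ) {L K : List (List ℤ)} {M : ℤ}
    {t : List ℤ} (h : Valid n σ L ((M :: t) :: K)) :
    Valid n (σ * bref M (-M)) ((M :: t.map (fun z => -z)) :: L) K := by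
  have hM0 : M ≠ 0 := h.ne0 (by simp)
  obtain ⟨b1, b2, b3⟩ := bref_mul_apply (σ := σ) hM0 (neg_ne_zero.2 hM0)
  simp only [Int.natAbs_neg] at b3
  have hnd := (h.nodup_of_mem (l := M :: t) (by simp))
  have hc := h.neg _ (List.mem_cons_self)
  simp only [Cyc] at hc
  rw [List.map_cons, List.nodup_cons] at hnd
  have := h.upd (σ' := σ * bref M (-M)) (K0 := [M :: t]) (L' := L) (L0 := []) (K' := K)
    (L1 := [M :: t.map (fun z => -z)]) (K1 := []) (by simp) (by simp)
    (by intro z hz; simp at hz; apply b3 <;> tauto)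
    (by
      intro l hl
      simp only [List.mem_singleton] at hl
      subst hl
      simp only [Cyc, one_mul]
      have := Wk_neg ho.1 _ _ _ hc
      simp only [neg_one_mul, neg_neg] at this
      refine Wk_head _ _ _ _ b1 (fun z hz => ?_) this
      obtain ⟨w, hw, rfl⟩ := List.mem_map.1 hz
      have := List.mem_map_of_mem (f := Int.natAbs) hw
      apply b3 <;> rw [Int.natAbs_neg] <;> intro e <;> rw [e] at this <;> exact hnd.1 this)
    (by simp)
    (by simp [natAbs_comp_neg])
  simpa using this

theorem Valid.step_neg4 {n : ℕ} {σ : Equiv.Perm ℤ} (ho : inB n σ) {L K : List (List ℤ)} {M x : ℤ}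
    {t s : List ℤ} (h : Valid n σ L ((M :: t) :: (x :: s) :: K)) :
    Valid n (σ * bref M x) ((M :: (s ++ (-x) :: t.map (fun z => -z))) :: L) K := by
  have hM0 : M ≠ 0 := h.ne0 (by simp)
  have hx0 : x ≠ 0 := h.ne0 (by simp)
  obtain ⟨b1, b2, b3⟩ := bref_mul_apply (σ := σ) hM0 hx0
  have hnd : ((M :: (t ++ x :: s)).map Int.natAbs).Nodup := by
    refine h.nodup.sublist (List.Sublist.map _ ?_)
    simp
  obtain ⟨n1, n2⟩ := nd_split hnd
  have hc := h.neg _ (List.mem_cons_self)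
  have hc2 := h.neg (x :: s) (by simp)
  simp only [Cyc, neg_one_mul] at hc hc2
  have hσ' : (σ * bref M x) (-x) = σ (-M) := by
    rw [(ho.mul (bref_inB (n := n) (h.mem_iff.1 (by simp)) (h.mem_iff.1 (by simp)))).1, b2, ho.1]
  have := h.upd (σ' := σ * bref M x) (K0 := [M :: t, x :: s]) (L' := L) (L0 := []) (K' := K)
    (L1 := [M :: (s ++ (-x) :: t.map (fun z => -z))]) (K1 := []) (by simp) (by simp)
    (by intro z hz; simp at hz; apply b3 <;> tauto)
    (by
      intro l hl
      simp only [List.mem_singleton] at hl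
      subst hl
      simp only [Cyc, one_mul]
      rw [Wk_append]
      constructor
      · exact Wk_head _ _ _ _ b1 (fun z hz => b3 z (n2 z hz).1 (n2 z hz).2) hc2
      have := Wk_neg ho.1 _ _ _ hc
      rw [neg_neg] at this
      refine Wk_head _ _ _ _ hσ' (fun z hz => ?_) this
      obtain ⟨w, hw, rfl⟩ := List.mem_map.1 hz
      apply b3 <;> rw [Int.natAbs_neg]
      exacts [(n1 w hw).1, (n1 w hw).2])
    (by simp)
    (by rw [List.perm_iff_count]; intro z
        simp [List.count_cons, natAbs_comp_neg]; omega)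
  simpa using this

/-- sums over positions -/
theorem sum_positions {t : List ℤ} {g : ℤ → ℚ} : ∀ {h : ℕ → ℕ → ℚ},
    (∀ t1 x t2, t = t1 ++ x :: t2 → g x = h t1.length t2.length) →
    (t.map g).sum = ∑ i ∈ Finset.range t.length, h i (t.length - 1 - i) := by
  induction t with
  | nil => intro h _; simp
  | cons a t ih =>
    intro h H
    rw [List.map_cons, List.sum_cons, List.length_cons, Finset.sum_range_succ', add_comm,
      H [] a t rfl]
    congr 1
    rw [ih (h := fun i j => h (i + 1) j)]
    · apply Finset.sum_congr rfl
      intro i hi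
      congr 1
      omega
    · intro t1 x t2 e
      rw [H (a :: t1) x t2 (by simp [e])]
      simp

end Jsec

section Isec
open Finset

theorem cb_ct (k : ℕ) : (Nat.centralBinom k : ℚ) = (k + 1) * (catalan k : ℚ) := by
  have := succ_mul_catalan_eq_centralBinom k
  exact_mod_cast this.symm

theorem ct_succ (k : ℕ) : (catalan (k + 1) : ℚ) =
    ∑ i ∈ range (k + 1), (catalan i : ℚ) * catalan (k - i) := by
  rw [catalan_succ]
  push_cast
  rw [Finset.sum_range (fun i => (catalan i : ℚ) * catalan (k - i))]

theorem cb_conv (k : ℕ) : (Nat.centralBinom (k + 1) : ℚ) =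
    2 * ∑ i ∈ range (k + 1), (catalan i : ℚ) * Nat.centralBinom (k - i) := by
  have h1 : ∑ i ∈ range (k + 1), (catalan i : ℚ) * Nat.centralBinom (k - i) =
      ∑ i ∈ range (k + 1), ((k - i : ℕ) + 1 : ℚ) * (catalan i * catalan (k - i)) := by
    apply sum_congr rfl; intro i _; rw [cb_ct]; ring
  have h2 : ∑ i ∈ range (k + 1), ((k - i : ℕ) + 1 : ℚ) * ((catalan i : ℚ) * catalan (k - i)) =
      ∑ i ∈ range (k + 1), ((i : ℚ) + 1) * (catalan i * catalan (k - i)) := by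
    rw [← sum_range_reflect]
    apply sum_congr rfl
    intro i hi
    have hi := mem_range.1 hi
    have e1 : k + 1 - 1 - i = k - i := by omega
    have e2 : k - (k - i) = i := by omega
    rw [e1, e2]; ring
  have h3 : 2 * ∑ i ∈ range (k + 1), ((k - i : ℕ) + 1 : ℚ) * ((catalan i : ℚ) * catalan (k - i)) =
      (k + 2) * catalan (k + 1) := by
    rw [two_mul]; nth_rewrite 2 [h2]
    rw [← sum_add_distrib, ct_succ, mul_sum]
    apply sum_congr rfl
    intro i hi
    have hi := mem_range.1 hi
    rw [Nat.cast_sub (by omega)]; ring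
  rw [h1, h3, cb_ct]; push_cast; ring

theorem cb_succ (k : ℕ) : ((k : ℚ) + 1) * Nat.centralBinom (k + 1) =
    2 * (2 * k + 1) * Nat.centralBinom k := by
  exact_mod_cast Nat.succ_mul_centralBinom_succ k

/-- the function `V` -/
def Vq (p q : ℕ) : ℚ := (p : ℚ) / (p + q) * Nat.centralBinom p * Nat.centralBinom q

theorem Vq_zero (q : ℕ) : Vq 0 q = 0 := by simp [Vq]

theorem Vq_shift (p q : ℕ) : Vq p (q + 1) =
    Vq (p + 1) q - 2 * catalan q * Nat.centralBinom p := by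
  have h1 := cb_succ p
  have h2 := cb_succ q
  have h3 := cb_ct q
  unfold Vq
  have hp : (0:ℚ) < (p:ℚ) + 1 := by positivity
  have hq : (0:ℚ) < (q:ℚ) + 1 := by positivity
  have e1 : (Nat.centralBinom (p+1) : ℚ) = 2 * (2 * p + 1) * Nat.centralBinom p / (p + 1) := by
    rw [← h1]; field_simp
  have e2 : (Nat.centralBinom (q+1) : ℚ) = 2 * (2 * q + 1) * Nat.centralBinom q / (q + 1) := by
    rw [← h2]; field_simp
  have hpq : (p:ℚ) + 1 + q ≠ 0 := by positivity
  have hpq' : (p:ℚ) + (q + 1) ≠ 0 := by positivity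
  rw [e1, e2, h3]
  push_cast
  field_simp
  ring

theorem Vq_rec (q : ℕ) : ∀ r : ℕ, Vq (r + 1) q =
    2 * catalan (r + q) + 2 * ∑ i ∈ range (r + 1), (catalan i : ℚ) * Vq (r - i) q := by
  induction q with
  | zero =>
    intro r
    have hV : ∀ j, 0 < j → Vq j 0 = Nat.centralBinom j := by
      intro j hj
      have : (j : ℚ) ≠ 0 := by positivity
      simp [Vq, this]
    rw [hV _ (by omega), cb_conv, sum_range_succ, sum_range_succ]
    have : ∑ i ∈ range r, (catalan i : ℚ) * Vq (r - i) 0 =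
        ∑ i ∈ range r, (catalan i : ℚ) * Nat.centralBinom (r - i) := by
      apply sum_congr rfl
      intro i hi
      have hi := mem_range.1 hi
      rw [hV _ (by omega)]
    rw [this]
    simp [Vq_zero]
    ring
  | succ q ih =>
    intro r
    rw [Vq_shift, ih, sum_range_succ _ (r + 1)]
    have : ∑ i ∈ range (r + 1), (catalan i : ℚ) * Vq (r - i) (q + 1) =
        ∑ i ∈ range (r + 1), (catalan i : ℚ) * Vq (r + 1 - i) q -
          2 * catalan q * ∑ i ∈ range (r + 1), (catalan i : ℚ) * Nat.centralBinom (r - i) := by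
      rw [mul_sum, ← sum_sub_distrib]
      apply sum_congr rfl
      intro i hi
      have hi := mem_range.1 hi
      rw [Vq_shift, show r - i + 1 = r + 1 - i by omega]
      ring
    rw [this, cb_conv]
    simp [Vq_zero]
    rw [show r + 1 + q = r + (q + 1) by ring]
    ring

/-- value for negative cycles -/
def GG : List ℕ → ℚ
  | [] => 1
  | [a] => Nat.centralBinom a / 2
  | [a, b] => Nat.centralBinom a * Nat.centralBinom b * (1 / 4 + a * b / (a + b))
  | _ => 0

theorem GG_perm {l l' : List ℕ} (h : l.Perm l') : GG l = GG l' := by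
  induction h with
  | nil => rfl
  | @cons x l1 l2 h ih =>
    rcases l1 with _ | ⟨a, _ | ⟨b, l1⟩⟩
    · rw [h.nil_eq]
    · rw [List.singleton_perm.1 h]
    · have := h.length_eq
      rcases l2 with _ | ⟨a', _ | ⟨b', l2⟩⟩
      · simp at this
      · simp at this
      · rfl
  | swap x y l =>
    cases l with
    | nil => simp only [GG]; rw [add_comm (x : ℚ)]; ring
    | cons a l => rfl
  | trans _ _ h1 h2 => rw [h1, h2]

theorem refl_sum (Φ : ℕ → ℚ) (r : ℕ) :
    ∑ i ∈ range r, (catalan (r - 1 - i) : ℚ) * Φ (i + 1) =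
      ∑ i ∈ range r, (catalan i : ℚ) * Φ (r - 1 - i + 1) := by
  rw [← sum_range_reflect]
  apply sum_congr rfl
  intro i hi
  have hi := mem_range.1 hi
  rw [show r - 1 - (r - 1 - i) = i by omega]

theorem GG_one (r : ℕ) : GG [r + 1] =
    ∑ i ∈ range r, (catalan i : ℚ) * GG [r - 1 - i + 1] +
    ∑ i ∈ range r, (catalan (r - 1 - i) : ℚ) * GG [i + 1] + catalan r * GG [] := by
  rw [refl_sum (fun j => GG [j])]
  simp only [GG]
  rw [cb_conv, sum_range_succ]
  have : ∑ i ∈ range r, (catalan i : ℚ) * (Nat.centralBinom (r - 1 - i + 1) / 2) =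
      (∑ i ∈ range r, (catalan i : ℚ) * Nat.centralBinom (r - i)) / 2 := by
    rw [sum_div]
    apply sum_congr rfl
    intro i hi
    have hi := mem_range.1 hi
    rw [show r - 1 - i + 1 = r - i by omega]; ring
  rw [this]; simp [mul_add, mul_comm]; try ring

theorem GG_two_V (p q : ℕ) : GG [p, q] =
    Nat.centralBinom p * Nat.centralBinom q / 4 + q * Vq p q := by
  simp only [GG, Vq]; ring

theorem GG_two (r q : ℕ) : GG [r + 1, q] =
    ∑ i ∈ range r, (catalan i : ℚ) * GG [r - 1 - i + 1, q] +
    ∑ i ∈ range r, (catalan (r - 1 - i) : ℚ) * GG [i + 1, q] + catalan r * GG [q] +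
    2 * q * catalan (r + q) := by
  rw [refl_sum (fun j => GG [j, q])]
  simp only [GG_two_V]
  rw [Vq_rec, cb_conv, sum_range_succ, sum_range_succ]
  have : ∑ i ∈ range r, (catalan i : ℚ) * (Nat.centralBinom (r - 1 - i + 1) *
        Nat.centralBinom q / 4 + q * Vq (r - 1 - i + 1) q) =
      (∑ i ∈ range r, (catalan i : ℚ) * Nat.centralBinom (r - i)) * Nat.centralBinom q / 4 +
      q * ∑ i ∈ range r, (catalan i : ℚ) * Vq (r - i) q := by
    rw [mul_sum, sum_mul, sum_div, ← sum_add_distrib]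
    apply sum_congr rfl
    intro i hi
    have hi := mem_range.1 hi
    rw [show r - 1 - i + 1 = r - i by omega]; ring
  rw [this]
  simp [Vq_zero, GG]; ring

theorem final_sum (p q : ℕ) (hp : 1 ≤ p) (hq : 1 ≤ q) :
    ((Nat.choose (2 * p - 1) p * Nat.choose (2 * q - 1) q +
          ∑ c ∈ Finset.Icc 1 p,
            2 * c * Nat.choose (2 * p - c - 1) (p - 1) *
              Nat.choose (2 * q + c - 1) (q - 1) : ℕ) : ℚ) = GG [p, q] := by
  have half : ∀ P : ℕ, (Nat.choose (2 * (P + 1) - 1) (P + 1) : ℚ) = Nat.centralBinom (P + 1) / 2 := by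
    intro P
    have h2 := Nat.choose_symm_half P
    have h3 : Nat.centralBinom (P + 1) = Nat.choose (2 * P + 1) (P + 1) + Nat.choose (2 * P + 1) P := by
      rw [Nat.centralBinom_eq_two_mul_choose, show 2 * (P + 1) = (2 * P + 1) + 1 by ring,
        Nat.choose_succ_succ, add_comm]
    rw [show 2 * (P + 1) - 1 = 2 * P + 1 by omega, h3, h2]; push_cast; ring
  obtain ⟨P, rfl⟩ : ∃ P, p = P + 1 := ⟨p - 1, by omega⟩
  obtain ⟨Q, rfl⟩ : ∃ Q, q = Q + 1 := ⟨q - 1, by omega⟩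
  rw [GG_two_V]
  push_cast
  rw [half, half]
  have key : ∑ c ∈ Finset.Icc 1 (P + 1), (2 * (c : ℚ) * Nat.choose (2 * (P + 1) - c - 1) (P + 1 - 1) *
              Nat.choose (2 * (Q + 1) + c - 1) (Q + 1 - 1)) = (Q + 1 : ℚ) * Vq (P + 1) (Q + 1) := by
    let T : ℕ → ℚ := fun j => 2 * (P + 1) * (Q + 1) / (P + Q + 2) *
      (Nat.choose (2 * P + 1 - j) (P + 1) * Nat.choose (2 * Q + 2 + j) (Q + 1))
    have e : ∑ c ∈ Finset.Icc 1 (P + 1), (2 * (c : ℚ) * Nat.choose (2 * (P + 1) - c - 1) (P + 1 - 1) *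
              Nat.choose (2 * (Q + 1) + c - 1) (Q + 1 - 1)) =
        ∑ j ∈ range (P + 1), (T j - T (j + 1)) := by
      rw [← Finset.Ico_add_one_right_eq_Icc, Finset.sum_Ico_eq_sum_range]
      apply sum_congr (by simp)
      intro j hj
      have hj := mem_range.1 hj
      have hj' : j ≤ P := by omega
      rw [show 2 * (P + 1) - (1 + j) - 1 = 2 * P - j by omega,
        show 2 * (Q + 1) + (1 + j) - 1 = 2 * Q + 2 + j by omega]
      simp only [Nat.add_sub_cancel, T]
      have a1 := Nat.add_one_mul_choose_eq (2 * P - j) P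
      have a2 := Nat.choose_succ_right_eq (2 * P - j) P
      have a3 := Nat.add_one_mul_choose_eq (2 * Q + 2 + j) Q
      have a4 := Nat.choose_succ_right_eq (2 * Q + 2 + j) Q
      rw [show 2 * P - j - P = P - j by omega] at a2
      rw [show 2 * Q + 2 + j - Q = Q + 2 + j by omega] at a4
      rw [show 2 * P + 1 - j = 2 * P - j + 1 by omega,
        show 2 * P + 1 - (j + 1) = 2 * P - j by omega,
        show 2 * Q + 2 + (j + 1) = 2 * Q + 2 + j + 1 by omega]
      have b1 : ((2 * P - j + 1 : ℚ)) * (Nat.choose (2 * P - j) P) =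
          (Nat.choose (2 * P - j + 1) (P + 1)) * (P + 1) := by
        have := congrArg (Nat.cast : ℕ → ℚ) a1
        push_cast at this
        rw [Nat.cast_sub (by omega)] at this
        push_cast at this; exact this
      have b2 : (Nat.choose (2 * P - j) (P + 1) : ℚ) * (P + 1) =
          (Nat.choose (2 * P - j) P) * (P - j) := by
        have := congrArg (Nat.cast : ℕ → ℚ) a2
        push_cast at this
        rw [Nat.cast_sub (by omega)] at this
        exact this
      have b3 : ((2 * Q + 2 + j + 1 : ℚ)) * (Nat.choose (2 * Q + 2 + j) Q) =
          (Nat.choose (2 * Q + 2 + j + 1) (Q + 1)) * (Q + 1) := by exact_mod_cast a3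
      have b4 : (Nat.choose (2 * Q + 2 + j) (Q + 1) : ℚ) * (Q + 1) =
          (Nat.choose (2 * Q + 2 + j) Q) * (Q + 2 + j) := by exact_mod_cast a4
      generalize (Nat.choose (2 * P - j) P : ℚ) = A at *
      generalize (Nat.choose (2 * Q + 2 + j) Q : ℚ) = B at *
      generalize (Nat.choose (2 * P - j + 1) (P + 1) : ℚ) = X1 at *
      generalize (Nat.choose (2 * P - j) (P + 1) : ℚ) = X2 at *
      generalize (Nat.choose (2 * Q + 2 + j + 1) (Q + 1) : ℚ) = X3 at *
      generalize (Nat.choose (2 * Q + 2 + j) (Q + 1) : ℚ) = X4 at *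
      have hpq : (P : ℚ) + Q + 2 ≠ 0 := by positivity
      have t1 : 2 * ((P:ℚ) + 1) * (Q + 1) / (P + Q + 2) * (X1 * X4) =
        2 / (P + Q + 2) * ((X1 * (P + 1)) * (X4 * (Q + 1))) := by ring
      have t2 : 2 * ((P:ℚ) + 1) * (Q + 1) / (P + Q + 2) * (X2 * X3) =
        2 / (P + Q + 2) * ((X2 * (P + 1)) * (X3 * (Q + 1))) := by ring
      rw [t1, t2, ← b1, ← b3, b2, b4]
      push_cast
      field_simp
      ring
    rw [e, Finset.sum_range_sub']
    have z : T (P + 1) = 0 := by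
      simp only [T]
      rw [Nat.choose_eq_zero_of_lt (show 2 * P + 1 - (P + 1) < P + 1 by omega)]; simp
    rw [z, sub_zero]
    simp only [T, Vq]
    rw [Nat.sub_zero, Nat.add_zero, show 2 * Q + 2 = 2 * (Q + 1) by ring,
      ← Nat.centralBinom_eq_two_mul_choose]
    have := half P
    rw [show 2 * (P + 1) - 1 = 2 * P + 1 by omega] at this
    rw [this]
    push_cast
    have hpq : (P : ℚ) + Q + 2 ≠ 0 := by positivity
    have hpq' : (P : ℚ) + 1 + (Q + 1) ≠ 0 := by positivity
    field_simp
    ring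
  push_cast at key
  rw [key]; ring

end Isec

section Nsec
open Equiv Equiv.Perm

/-- the closed form value -/
def Val (n : ℕ) (Ls Ks : List ℕ) : ℚ :=
  (-1) ^ (n + Ls.length) * (Ls.map (fun a => (catalan (a - 1) : ℚ))).prod * GG Ks

theorem Val_perm {n : ℕ} {Ls Ls' Ks Ks' : List ℕ} (h : Ls.Perm Ls') (h' : Ks.Perm Ks') :
    Val n Ls Ks = Val n Ls' Ks' := by
  unfold Val
  rw [h.length_eq, (h.map _).prod_eq, GG_perm h']

theorem Val_fac (n : ℕ) (Ls Ks : List ℕ) : Val n Ls Ks = Val n Ls [] * GG Ks := by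
  simp [Val, GG]

theorem Val_cons (n a : ℕ) (Ls Ks : List ℕ) :
    Val n ((a + 1) :: Ls) Ks = - Val n Ls [] * (catalan a * GG Ks) := by
  simp [Val, GG]; ring

theorem RR_down {n : ℕ} {σ : Equiv.Perm ℤ} (ho : inB n σ) {M x : ℤ} (hM : M ∈ signedSet n)
    (hx : x ∈ signedSet n) (hne : M ≠ x) (hr : RR σ M x) :
    inB n (σ * bref M x) ∧ leB n (σ * bref M x) σ ∧ cc n (σ * bref M x) + 1 = cc n σ := by
  have h1 := ho.mul (bref_inB hM hx)
  have h2 := (cc_bref_down ho hM hx hne).2 ((RR_iff ho hM hx).1 hr)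
  refine ⟨h1, ?_, h2⟩
  rw [leB_iff h1 ho, mul_inv_rev, inv_mul_cancel_right, bref_inv (mem_ss.1 hM).1 (mem_ss.1 hx).1,
    cc_bref hM hx hne, h2]

theorem Valid.id_val {n : ℕ} {L K : List (List ℤ)} (h : Valid n 1 L K) :
    Val n (L.map List.length) (K.map List.length) = 1 := by
  have hK : K = [] := by
    rcases K with _ | ⟨l, K⟩
    · rfl
    · exfalso
      have h1 := h.neg l (by simp)
      rcases l with _ | ⟨a, t⟩
      · exact h1
      · have := (Cyc_same_neg (y := -a) (fun x => by simp) h1 (x := a) (by simp)).2 (by simp)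
        have ha : a ≠ 0 := h.ne0 (by simp)
        rw [sameCycle_one] at this
        omega
  subst hK
  have hL : ∀ l ∈ L, l.length = 1 := by
    intro l hl
    have h1 := h.pos l hl
    have hnd := h.nodup_of_mem (l := l) (by simp [hl])
    rcases l with _ | ⟨a, _ | ⟨b, t⟩⟩
    · exact h1.elim
    · rfl
    · exfalso
      simp only [Cyc, Wk, Equiv.Perm.one_apply] at h1
      simp [h1.1] at hnd
  have hmap : L.map List.length = List.replicate L.length 1 := by
    rw [List.eq_replicate_iff]
    refine ⟨by simp, ?_⟩
    intro b hb
    obtain ⟨l, hl, rfl⟩ := List.mem_map.1 hb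
    exact hL l hl
  have hlen : L.length = n := by
    have := h.cov.length_eq
    rw [List.length_map, List.append_nil, List.length_flatten, hmap] at this
    simpa using this
  rw [hmap, hlen]
  simp [Val, GG, ← two_mul]

open Classical in
theorem eval_f {n : ℕ} {γ : Equiv.Perm ℤ} (hγ : inB n γ) (f : Equiv.Perm ℤ → ℚ) (hf1 : f 1 = 1)
    (H : ∀ σ, inB n σ → leB n σ γ → σ ≠ 1 →
      ∑ τ ∈ (Bfin n).filter (fun τ => leB n τ σ), f τ = 0) :
    ∀ k, ∀ σ, cc n σ = k → inB n σ → leB n σ γ → ∀ L K, Valid n σ L K → K.length ≤ 2 →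
      f σ = Val n (L.map List.length) (K.map List.length) := by
  intro k
  induction k using Nat.strong_induction_on with
  | _ k ih =>
  intro σ hk hσ hle L K hV hK2
  by_cases h1 : σ = 1
  · subst h1; rw [hf1, hV.id_val]
  obtain ⟨m, hmn, hσm, hmove⟩ : ∃ m : ℕ, m + 1 ≤ n ∧ inB (m + 1) σ ∧ σ ((m:ℤ) + 1) ≠ (m:ℤ) + 1 := by
    have hex : ∃ j, inB j σ := ⟨n, hσ⟩
    have hs := Nat.find_spec hex
    have hmin := fun j => Nat.find_min hex (m := j)
    have hlen := Nat.find_min' hex hσ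
    rcases hj : Nat.find hex with _ | m
    · exfalso; apply h1; rw [hj] at hs
      ext x; exact hs.2 x (by rw [mem_ss]; simp; omega)
    · rw [hj] at hs hlen hmin
      refine ⟨m, hlen, hs, ?_⟩
      intro hfix
      apply hmin m (by omega)
      refine ⟨hs.1, ?_⟩
      intro x hx
      by_cases hx1 : x ∈ signedSet (m + 1)
      · have : x = (m:ℤ) + 1 ∨ x = -((m:ℤ) + 1) := by
          rw [mem_ss] at hx hx1; push_cast at hx1; omega
        rcases this with rfl | rfl
        · exact hfix
        · rw [hs.1, hfix]
      · exact hs.2 x hx1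
  have hT := teles hγ f H m hmn _ σ rfl hσm hmove hle
  set M : ℤ := (m:ℤ) + 1 with hMdef
  have hM0 : M ≠ 0 := by omega
  have hMn : M ∈ signedSet n := by rw [mem_ss]; omega
  have hMm : M ∈ signedSet (m+1) := by rw [mem_ss]; push_cast; omega
  have IH : ∀ x, M ≠ x → x ≠ 0 → RR σ M x → ∀ L K, Valid n (σ * bref M x) L K → K.length ≤ 2 →
      f (σ * bref M x) = Val n (L.map List.length) (K.map List.length) := by
    intro x hne hx hr L K hV hK
    have hxn := RR_mem hσ hMn hr hx
    obtain ⟨d1, d2, d3⟩ := RR_down hσ hMn hxn hne hr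
    exact ih _ (by omega) _ rfl d1 (leB_trans d1 hσ hγ d2 hle) L K hV hK
  have hsum : ∀ c : List ℤ, c.Nodup → (∀ x, x ∈ c ↔ x ≠ 0 ∧ RR σ M x) →
      (c.map (fun x => f (σ * bref M x))).sum = 0 := by
    intro c hc hmem
    rw [← List.sum_toFinset _ hc, ← hT]
    apply Finset.sum_congr _ (fun _ _ => rfl)
    ext x
    rw [List.mem_toFinset, Finset.mem_filter, hmem, Finset.mem_Icc]
    constructor
    · intro hx
      have := RR_mem hσm hMm hx.2 hx.1
      rw [mem_ss] at this; push_cast at this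
      exact ⟨⟨by omega, by omega⟩, hx⟩
    · exact fun hx => hx.2
  have hgM : f (σ * bref M M) = f σ := by rw [bref_self hM0, mul_one]
  have hMmem := hV.mem_iff.2 hMn
  rw [List.flatten_append, List.map_append, List.mem_append] at hMmem
  rcases hMmem with hMmem | hMmem
  · obtain ⟨t, L', hV', hp⟩ := hV.normL hσ hMmem
    rw [Val_perm hp (List.Perm.refl _)]
    obtain ⟨-, hRR⟩ := hV'.RR_pos
    have hnd := hV'.nodup_of_mem (l := M :: t) (by simp)
    have hnd' : (M :: t).Nodup := List.Nodup.of_map _ hnd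
    have ht0 : t ≠ [] := by
      rintro rfl
      have := hV'.pos [M] (by simp)
      simp only [Cyc, Wk, one_mul] at this
      exact hmove this
    have hS := hsum (M :: t) hnd' (by
      intro x; rw [hRR]
      refine ⟨fun hx => ⟨hV'.ne0 ?_, hx⟩, fun hx => hx.2⟩
      have := List.mem_map_of_mem (f := Int.natAbs) hx
      rw [List.cons_append, List.flatten_cons, List.map_append, List.mem_append]
      exact Or.inl this)
    rw [List.map_cons, List.sum_cons, hgM, sum_positions
      (h := fun i j => Val n ((j + 1) :: (i + 1) :: L'.map List.length) (K.map List.length))] at hS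
    · rw [eq_neg_of_add_eq_zero_left hS]
      obtain ⟨r, hr⟩ : ∃ r, t.length = r + 1 := ⟨t.length - 1, by
        have := List.length_pos_iff.2 ht0; omega⟩
      rw [hr]
      simp only [Val, List.length_cons, List.map_cons, List.prod_cons, Nat.add_sub_cancel]
      rw [ct_succ, Finset.sum_mul, Finset.mul_sum, Finset.sum_mul, ← Finset.sum_neg_distrib]
      apply Finset.sum_congr rfl
      intro i _
      ring
    · rintro t1 x t2 rfl
      have hxne : M ≠ x := by
        rintro rfl; simp at hnd'
      have hx0 : x ≠ 0 := hV'.ne0 (by simp)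
      have := IH x hxne hx0 ((hRR x).2 (by simp)) _ _ hV'.step_pos hK2
      simpa using this
  · obtain ⟨t, K', hV', hp⟩ := hV.normK hσ hMmem
    rw [Val_perm (List.Perm.refl _) hp]
    have hK1 : K'.length ≤ 1 := by
      have := hp.length_eq; simp at this; omega
    have hRR := fun x => hV'.RR_neg hσ (x := x)
    have hne0 : ∀ x : ℤ, x.natAbs ∈ (((M :: t) :: K').flatten).map Int.natAbs → x ≠ 0 := by
      intro x hx
      apply hV'.ne0
      rw [List.flatten_append, List.map_append, List.mem_append]; exact Or.inr hx
    have hnd : (((M :: t) :: K').flatten.map Int.natAbs).Nodup := by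
      have := hV'.nodup
      rw [List.flatten_append, List.map_append] at this
      exact this.of_append_right
    set F := ((M :: t) :: K').flatten with hF
    have hFM : F = M :: (t ++ K'.flatten) := by simp [hF]
    have hndc : (F ++ F.map (fun z => -z)).Nodup := by
      have hFn : F.Nodup := List.Nodup.of_map _ hnd
      rw [List.nodup_append]
      refine ⟨hFn, hFn.map neg_injective, ?_⟩
      rintro a ha b hb rfl
      obtain ⟨w, hw, rfl⟩ := List.mem_map.1 hb
      have : w = -w := List.inj_on_of_nodup_map hnd hw ha (by simp)
      have := hne0 w (List.mem_map_of_mem hw)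
      omega
    have hS := hsum _ hndc (by
      intro x
      have hm : x ∈ F ++ F.map (fun z => -z) ↔ x.natAbs ∈ F.map Int.natAbs := by
        simp only [List.mem_append, List.mem_map]
        constructor
        · rintro (h | ⟨a, h, rfl⟩)
          · exact ⟨x, h, rfl⟩
          · exact ⟨a, h, by simp⟩
        · rintro ⟨a, h, e⟩
          rcases Int.natAbs_eq_natAbs_iff.1 e with rfl | rfl
          · exact Or.inl h
          · exact Or.inr ⟨-x, h, by simp⟩
      rw [hm]
      constructor
      · intro h
        exact ⟨hne0 x h, (hRR x (hne0 x h)).2 h⟩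
      · rintro ⟨h0, h⟩
        exact (hRR x h0).1 h)
    rw [hFM] at hS
    simp only [List.map_cons, List.map_append, List.sum_append, List.sum_cons, List.map_map,
      List.cons_append, hgM] at hS
    have hFmem : ∀ x : ℤ, x.natAbs ∈ F.map Int.natAbs → RR σ M x :=
      fun x hx => (hRR x (hne0 x hx)).2 hx
    have s1 : (t.map (fun x => f (σ * bref M x))).sum = ∑ i ∈ Finset.range t.length,
        Val n ((i + 1) :: L.map List.length) ((t.length - 1 - i + 1) :: K'.map List.length) := by
      apply sum_positions (h := fun i j =>
        Val n ((i + 1) :: L.map List.length) ((j + 1) :: K'.map List.length))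
      rintro t1 x t2 rfl
      have hxF : x.natAbs ∈ F.map Int.natAbs := by rw [hFM]; simp
      have hxne : M ≠ x := by
        rintro rfl; rw [hFM] at hnd; simp at hnd
      have := IH x hxne (hne0 x hxF) (hFmem x hxF) _ _ hV'.step_neg1 (by simp; omega)
      simpa using this
    have s2 : (t.map ((fun x => f (σ * bref M x)) ∘ (fun z => -z))).sum =
        ∑ i ∈ Finset.range t.length,
        Val n ((t.length - 1 - i + 1) :: L.map List.length) ((i + 1) :: K'.map List.length) := by
      apply sum_positions (h := fun i j =>
        Val n ((j + 1) :: L.map List.length) ((i + 1) :: K'.map List.length))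
      rintro t1 x t2 rfl
      have hxF : (-x).natAbs ∈ F.map Int.natAbs := by rw [hFM]; simp
      have hxne : M ≠ -x := by
        intro e
        rw [hFM, e] at hnd; simp at hnd
      have := IH (-x) hxne (hne0 _ hxF) (hFmem _ hxF) _ _ (hV'.step_neg2 hσ) (by simp; omega)
      simpa using this
    have s3 : f (σ * bref M (-M)) = Val n ((t.length + 1) :: L.map List.length)
        (K'.map List.length) := by
      have hxF : (-M).natAbs ∈ F.map Int.natAbs := by rw [hFM]; simp
      have := IH (-M) (by omega) (hne0 _ hxF) (hFmem _ hxF) _ _ (hV'.step_neg3 hσ) (by omega)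
      simpa using this
    rw [s1, s2, s3] at hS
    rcases K' with _ | ⟨s, _ | ⟨s', K'⟩⟩
    · simp only [List.flatten_nil, List.map_nil, List.sum_nil, add_zero] at hS ⊢
      rw [eq_neg_of_add_eq_zero_left hS, Val_fac n _ [t.length + 1], GG_one]
      simp only [Val_cons]
      simp only [mul_assoc, ← Finset.mul_sum]
      ring
    · simp only [List.flatten_cons, List.flatten_nil, List.append_nil, List.map_nil, List.map_cons] at hS ⊢
      have s4 : ∀ x : ℤ, x.natAbs ∈ s.map Int.natAbs → f (σ * bref M x) =
          Val n ((t.length + s.length + 1) :: L.map List.length) [] := by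
        intro x hx
        have hxF : x.natAbs ∈ F.map Int.natAbs := by
          rw [hFM]; simp at hx ⊢; tauto
        have hxne : M ≠ x := by
          rintro rfl
          rw [hFM] at hnd
          simp at hnd hx
          tauto
        obtain ⟨s', h1, h2⟩ := Cyc_rot hσ.1 (Or.inr rfl) (hV'.neg s (by simp)) hx
        have hV2 := hV'.upd (σ' := σ) (L0 := []) (L' := L) (K0 := [M :: t, s]) (K' := [])
          (L1 := []) (K1 := [M :: t, x :: s']) (by simp) (by simp) (by simp) (by simp)
          (by
            intro l hl
            simp only [List.mem_cons, List.not_mem_nil, or_false] at hl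
            rcases hl with rfl | rfl
            · exact hV'.neg _ (by simp)
            · exact h1)
          (by
            rw [List.perm_iff_count] at h2 ⊢
            intro z
            have := h2 z
            simp [List.count_cons] at this ⊢
            omega)
        have := IH x hxne (hne0 _ hxF) (hFmem _ hxF) _ _ (Valid.step_neg4 hσ hV2) (by simp)
        rw [this]
        have hl := h2.length_eq
        simp at hl
        simp
        congr 2
        omega
      have s5 : (s.map (fun x => f (σ * bref M x))).sum = s.length *
          Val n ((t.length + s.length + 1) :: L.map List.length) [] := by
        rw [sum_positions (h := fun _ _ => Val n ((t.length + s.length + 1) :: L.map List.length) [])]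
        · simp
        · rintro t1 x t2 rfl
          exact s4 x (by simp)
      have s6 : (s.map ((fun x => f (σ * bref M x)) ∘ (fun z => -z))).sum = s.length *
          Val n ((t.length + s.length + 1) :: L.map List.length) [] := by
        rw [sum_positions (h := fun _ _ => Val n ((t.length + s.length + 1) :: L.map List.length) [])]
        · simp
        · rintro t1 x t2 rfl
          exact s4 (-x) (by simp)
      rw [s5, s6] at hS
      have hS' := eq_neg_of_add_eq_zero_left hS
      rw [hS', Val_fac n _ [t.length + 1, s.length], GG_two]
      simp only [Val_cons]
      simp only [mul_assoc, ← Finset.mul_sum, show GG [] = 1 from rfl, mul_one]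
      ring
    · simp at hK1

end Nsec

section Qsec
open Equiv Equiv.Perm

theorem Wk_of_getElem {σ : Equiv.Perm ℤ} (t : List ℤ) (b : ℤ) : ∀ a : ℤ,
    (∀ i, (h : i + 1 < (a :: (t ++ [b])).length) →
      σ ((a :: (t ++ [b]))[i]'(by omega)) = (a :: (t ++ [b]))[i + 1]) → Wk σ a t b := by
  induction t with
  | nil => intro a h; simpa [Wk] using h 0 (by simp)
  | cons x t ih =>
    intro a h
    refine ⟨by simpa using h 0 (by simp), ih x ?_⟩
    intro i hi
    have := h (i + 1) (by simp at hi ⊢; omega)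
    simpa using this

theorem Wk_formPerm {a : ℤ} {t : List ℤ} (hnd : (a :: t).Nodup) : Wk (a :: t).formPerm a t a := by
  apply Wk_of_getElem
  intro i hi
  simp only [List.length_cons, List.length_append, List.length_nil] at hi
  have h1 := List.formPerm_apply_getElem (a :: t) hnd i (by simp; omega)
  have e1 : (a :: (t ++ [a]))[i]'(by simp; omega) = (a :: t)[i]'(by simp; omega) := by
    have : a :: (t ++ [a]) = (a :: t) ++ [a] := rfl
    simp only [this]
    rw [List.getElem_append_left]
  rw [e1, h1]
  simp only [List.length_cons]
  rcases Nat.lt_or_ge (i + 1) (t.length + 1) with h | h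
  · simp only [Nat.mod_eq_of_lt h]
    simp only [List.getElem_cons_succ]
    rw [List.getElem_append_left]
  · have : i = t.length := by omega
    subst this
    simp

theorem Wk_odd {σ : Equiv.Perm ℤ} (t : List ℤ) (b : ℤ) : ∀ a, Wk σ a t b →
    Wk σ (-a) (t.map (fun z => -z)) (-b) → ∀ x ∈ a :: t, σ (-x) = - σ x := by
  induction t with
  | nil => intro a h1 h2 x hx; simp [Wk] at h1 h2 hx; subst hx; rw [h1, h2]
  | cons y t ih =>
    rintro a ⟨h1, h2⟩ ⟨h3, h4⟩ x hx
    rcases List.mem_cons.1 hx with rfl | hx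
    · rw [h1, h3]
    · exact ih y h2 h4 x hx

theorem nodup_pm {l : List ℤ} (hnd : (l.map Int.natAbs).Nodup) (h0 : (0:ℤ) ∉ l) :
    (l ++ l.map (fun z => -z)).Nodup := by
  have hFn : l.Nodup := List.Nodup.of_map _ hnd
  rw [List.nodup_append]
  refine ⟨hFn, hFn.map neg_injective, ?_⟩
  rintro a ha b hb rfl
  obtain ⟨w, hw, rfl⟩ := List.mem_map.1 hb
  have : w = -w := List.inj_on_of_nodup_map hnd hw ha (by simp)
  have hw0 : w = 0 := by omega
  exact h0 (hw0 ▸ hw)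

theorem formPerm_pm {l : List ℤ} (hl : l ≠ []) (hnd : (l.map Int.natAbs).Nodup) (h0 : (0:ℤ) ∉ l) :
    Cyc (l ++ l.map (fun z => -z)).formPerm (-1) l ∧
    (∀ x, (l ++ l.map (fun z => -z)).formPerm (-x) = - (l ++ l.map (fun z => -z)).formPerm x) ∧
    (∀ x, x.natAbs ∉ l.map Int.natAbs → (l ++ l.map (fun z => -z)).formPerm x = x) := by
  have hn := nodup_pm hnd h0
  rcases l with _ | ⟨a, t⟩
  · exact absurd rfl hl
  have hW := Wk_formPerm (a := a) (t := t ++ (-a) :: t.map (fun z => -z)) (by simpa using hn)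
  have e : (a :: t) ++ (a :: t).map (fun z => -z) = a :: (t ++ (-a) :: t.map (fun z => -z)) := by simp
  rw [e]
  have hfix : ∀ x, x.natAbs ∉ (a :: t).map Int.natAbs →
      (a :: (t ++ (-a) :: t.map (fun z => -z))).formPerm x = x := by
    intro x hx
    apply List.formPerm_apply_of_notMem
    rw [← e]
    intro hm
    apply hx
    rcases List.mem_append.1 hm with h | h
    · exact List.mem_map_of_mem h
    · obtain ⟨w, hw, rfl⟩ := List.mem_map.1 h
      rw [Int.natAbs_neg]; exact List.mem_map_of_mem hw
  set π := (a :: (t ++ (-a) :: t.map (fun z => -z))).formPerm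
  rw [Wk_append] at hW
  have hodd := Wk_odd t (-a) a hW.1 (by simpa using hW.2)
  refine ⟨by simpa [Cyc] using hW.1, ?_, hfix⟩
  intro x
  by_cases hx : x.natAbs ∈ (a :: t).map Int.natAbs
  · obtain ⟨w, hw, e⟩ := List.mem_map.1 hx
    rcases Int.natAbs_eq_natAbs_iff.1 e with rfl | rfl
    · exact hodd w hw
    · have := hodd _ hw
      rw [neg_neg] at this
      rw [this, neg_neg]
  · rw [hfix x hx, hfix (-x) (by rwa [Int.natAbs_neg])]

theorem gamma_valid (p q : ℕ) (hp : 1 ≤ p) (hq : 1 ≤ q) : inB (p + q) (gammaPQ p q) ∧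
    ∃ l1 l2 : List ℤ, l1.length = p ∧ l2.length = q ∧ Valid (p + q) (gammaPQ p q) [] [l1, l2] := by
  set l1 : List ℤ := (List.range p).map (fun i : ℕ => ((i : ℤ) + 1)) with hl1
  set l2 : List ℤ := (List.range q).map (fun i : ℕ => ((p : ℤ) + (i : ℤ) + 1)) with hl2
  have n1 : l1.map Int.natAbs = List.range' 1 p := by
    rw [hl1, List.map_map, List.range'_eq_map_range]
    apply List.map_congr_left; intro i _; simp; omega
  have n2 : l2.map Int.natAbs = List.range' (1 + p) q := by
    rw [hl2, List.map_map, List.range'_eq_map_range]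
    apply List.map_congr_left; intro i _; simp; omega
  have len1 : l1.length = p := by simp [hl1]
  have len2 : l2.length = q := by simp [hl2]
  have eγ : gammaPQ p q = (l1 ++ l1.map (fun z => -z)).formPerm *
      (l2 ++ l2.map (fun z => -z)).formPerm := by
    have hc : ∀ k : ℕ, (do let a ← List.range k; pure (a : ℤ) : List ℤ) =
        (List.range k).map (fun i : ℕ => (i : ℤ)) := by
      intro k
      exact List.flatMap_pure_eq_map _ _
    unfold gammaPQ
    simp only [hc, hl1, hl2, List.map_map]; rfl
  obtain ⟨c1, o1, f1⟩ := formPerm_pm (l := l1) (by intro h; rw [h] at len1; simp at len1; omega)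
    (by rw [n1]; exact List.nodup_range') (by simp [hl1]; omega)
  obtain ⟨c2, o2, f2⟩ := formPerm_pm (l := l2) (by intro h; rw [h] at len2; simp at len2; omega)
    (by rw [n2]; exact List.nodup_range') (by simp [hl2]; omega)
  set π1 := (l1 ++ l1.map (fun z => -z)).formPerm
  set π2 := (l2 ++ l2.map (fun z => -z)).formPerm
  rw [n1] at f1
  rw [n2] at f2
  simp only [List.mem_range'_1] at f1 f2
  have b1 : inB (p + q) π1 := ⟨o1, fun x hx => f1 x (by rw [mem_ss] at hx; push_cast at hx; omega)⟩
  have b2 : inB (p + q) π2 := ⟨o2, fun x hx => f2 x (by rw [mem_ss] at hx; push_cast at hx; omega)⟩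
  rw [eγ]
  refine ⟨b1.mul b2, l1, l2, len1, len2, by simp, ?_, ?_⟩
  · intro l hl
    simp only [List.mem_cons, List.not_mem_nil, or_false] at hl
    rcases hl with rfl | rfl
    · refine Cyc_congr (fun z hz => ?_) c1
      have := List.mem_map_of_mem (f := Int.natAbs) hz
      rw [n1, List.mem_range'_1] at this
      rw [mul_apply, f2 z (by omega)]
    · refine Cyc_congr (fun z hz => ?_) c2
      have := List.mem_map_of_mem (f := Int.natAbs) hz
      rw [n2, List.mem_range'_1] at this
      rw [mul_apply, f1]
      intro h
      have h2 := π2.injective (f2 (π2 z) (by omega))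
      rw [h2] at h; omega
  · simp only [List.nil_append, List.flatten_cons, List.flatten_nil, List.append_nil,
      List.map_append, n1, n2]
    rw [List.range'_append_1]

theorem omega_one (n : ℕ) : omegaTilde n 1 = botNCB n := by
  ext A
  rw [mem_omega (inB_one n)]
  unfold botNCB
  simp only [Set.mem_setOf_eq]
  apply exists_congr
  intro x
  apply and_congr_right
  intro hx
  have : {y | y ∈ signedSet n ∧ RR 1 x y} = {x} := by
    ext y
    simp only [Set.mem_setOf_eq, RR, sameCycle_one, Set.mem_singleton_iff]
    constructor
    · rintro ⟨_, h | h⟩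
      · exact h.symm
      · have := (mem_ss.1 hx).1; omega
    · rintro rfl; exact ⟨hx, Or.inl rfl⟩
  rw [this]

theorem omega_top {n : ℕ} (hn : 1 ≤ n) {σ : Equiv.Perm ℤ} (ho : inB n σ) {K : List (List ℤ)}
    (hV : Valid n σ [] K) : omegaTilde n σ = topNCB n := by
  have hs : ∀ x ∈ signedSet n, SameCycle σ x (-x) := by
    intro x hx
    have := hV.mem_iff.2 hx
    rw [List.nil_append] at this
    obtain ⟨l, hl, hMl⟩ := mem_flat this
    obtain ⟨t', h1, h2⟩ := Cyc_rot ho.1 (Or.inr rfl) (hV.neg l hl) hMl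
    rw [Cyc_same_neg ho.1 h1 (by simp)]; simp
  have hset : ∀ x ∈ signedSet n, {y | y ∈ signedSet n ∧ RR σ x y} = signedSet n := by
    intro x hx
    ext y
    exact ⟨fun h => h.1, fun h => ⟨h, Or.inr ⟨hs x hx, hs y h⟩⟩⟩
  ext A
  rw [mem_omega ho]
  simp only [topNCB, Set.mem_singleton_iff]
  constructor
  · rintro ⟨x, hx, rfl⟩; exact hset x hx
  · rintro rfl
    have h1 : (1:ℤ) ∈ signedSet n := by rw [mem_ss]; omega
    exact ⟨1, h1, (hset 1 h1).symm⟩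

open Classical in
theorem ncb_main (p q : ℕ) (hp : 1 ≤ p) (hq : 1 ≤ q)
    (μ : Set (Set ℤ) → Set (Set ℤ) → ℤ)
    (hrefl : ∀ x ∈ NCB p q, μ x x = 1)
    (hrec : ∀ x ∈ NCB p q, ∀ y ∈ NCB p q, refines x y → x ≠ y →
      (∑ᶠ z ∈ {z | z ∈ NCB p q ∧ refines x z ∧ refines z y}, μ x z) = 0) :
    (μ (botNCB (p + q)) (topNCB (p + q)) : ℚ) = (-1) ^ (p + q) * GG [p, q] := by
  obtain ⟨hγ, l1, l2, len1, len2, hV⟩ := gamma_valid p q hp hq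
  set γ := gammaPQ p q with hγdef
  set n := p + q with hn
  have hbot : botNCB n ∈ NCB p q := ⟨1, ⟨inB_one n, one_leB hγ⟩, (omega_one n).symm⟩
  have key := eval_f hγ (fun τ => (μ (botNCB n) (omegaTilde n τ) : ℚ))
    (by rw [omega_one, hrefl _ hbot]; simp) (by
      intro σ hσ hle hne
      have hinj : ∀ τ τ', inB n τ → inB n τ' → leB n τ γ → leB n τ' γ →
          omegaTilde n τ = omegaTilde n τ' → τ = τ' := by
        intro τ τ' a b c d e
        have r1 := (leB_iff_refines a b hγ c d).2 (e ▸ fun A hA => ⟨A, hA, subset_rfl⟩)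
        have r2 := (leB_iff_refines b a hγ d c).2 (e ▸ fun A hA => ⟨A, hA, subset_rfl⟩)
        exact leB_antisymm a b r1 r2
      have hb : ∀ τ, inB n τ → leB n τ γ → refines (botNCB n) (omegaTilde n τ) := by
        intro τ a b
        rw [← omega_one]
        exact (leB_iff_refines (inB_one n) a hγ (one_leB hγ) b).1 (one_leB a)
      have h0 := hrec (botNCB n) hbot (omegaTilde n σ) ⟨σ, ⟨hσ, hle⟩, rfl⟩ (hb σ hσ hle) (by
        intro e
        apply hne
        rw [← omega_one] at e
        exact (hinj 1 σ (inB_one n) hσ (one_leB hγ) hle e).symm)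
      have hset : {z | z ∈ NCB p q ∧ refines (botNCB n) z ∧ refines z (omegaTilde n σ)} =
          (((Bfin n).filter (fun τ => leB n τ σ)).image (omegaTilde n) : Finset (Set (Set ℤ))) := by
        ext z
        simp only [Set.mem_setOf_eq, Finset.coe_image, Set.mem_image, Finset.coe_filter, mem_Bfin]
        constructor
        · rintro ⟨⟨τ, ⟨h1, h2⟩, rfl⟩, _, h4⟩
          exact ⟨τ, ⟨h1, (leB_iff_refines h1 hσ hγ h2 hle).2 h4⟩, rfl⟩
        · rintro ⟨τ, ⟨h1, h2⟩, rfl⟩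
          have h3 := leB_trans h1 hσ hγ h2 hle
          exact ⟨⟨τ, ⟨h1, h3⟩, rfl⟩, hb τ h1 h3, (leB_iff_refines h1 hσ hγ h3 hle).1 h2⟩
      rw [hset, finsum_mem_coe_finset, Finset.sum_image] at h0
      · exact_mod_cast h0
      · intro τ hτ τ' hτ' e
        simp only [Finset.coe_filter, mem_Bfin, Set.mem_setOf_eq] at hτ hτ'
        exact hinj τ τ' hτ.1 hτ'.1 (leB_trans hτ.1 hσ hγ hτ.2 hle)
          (leB_trans hτ'.1 hσ hγ hτ'.2 hle) e)
    _ γ rfl hγ (leB_refl hγ) [] [l1, l2] hV (by simp)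
  rw [omega_top (by omega) hγ hV] at key
  rw [key]
  simp [Val, len1, len2]

end Qsec

/-- The Möbius function of `NC^B(p,q)` satisfies
`μ(0̂,1̂) = (-1)^{p+q}·(C(2p-1,p)·C(2q-1,q) + Σ_{c=1}^{p} 2c·C(2p-c-1,p-1)·C(2q+c-1,q-1))`. -/
theorem ncb_mobius (p q : ℕ) (hp : 1 ≤ p) (hq : 1 ≤ q)
    (μ : Set (Set ℤ) → Set (Set ℤ) → ℤ)
    (hrefl : ∀ x ∈ NCB p q, μ x x = 1)
    (hrec : ∀ x ∈ NCB p q, ∀ y ∈ NCB p q, refines x y → x ≠ y →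
      (∑ᶠ z ∈ {z | z ∈ NCB p q ∧ refines x z ∧ refines z y}, μ x z) = 0) :
    μ (botNCB (p + q)) (topNCB (p + q)) =
      (-1 : ℤ) ^ (p + q) *
        ((Nat.choose (2 * p - 1) p * Nat.choose (2 * q - 1) q +
          ∑ c ∈ Finset.Icc 1 p,
            2 * c * Nat.choose (2 * p - c - 1) (p - 1) *
              Nat.choose (2 * q + c - 1) (q - 1) : ℕ) : ℤ) := by
  have h := ncb_main p q hp hq μ hrefl hrec
  rw [← final_sum p q hp hq] at h
  exact_mod_cast h
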